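/- Let (R, m) be a complete Noetherian local ring and M a finite R-module of Krull dimension n ≥ 1. Then the number of isomorphism classes of the R-modules H^n_a(M), as a ranges over all ideals of R, equals 2^{|Assh_R(M)|}. -/

import Mathlib

/-!
STATEMENT 9 (Dibaei–Jafari, Corollary 2.9): the number of non-isomorphic top local cohomology
modules `H^n_a(M)`, as `a` ranges over all ideals of `R`, is `2 ^ |Assh_R(M)|`.
-/

open CategoryTheory

noncomputable section

universe u

/-- A prime ideal `p` is an *attached prime* of the `R`-module `N` if `p` is the annihilator
of some quotient of `N`. -/
def attachedPrimes (R : Type u) [CommRing R] (N : Type u) [AddCommGroup N] [Module R N] :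
    Set (Ideal R) :=
  { p | p.IsPrime ∧ ∃ K : Submodule R N, p = Module.annihilator R (N ⧸ K) }

/-- `Assh_R(M)`: the associated primes `p` of `M` with `dim (R ⧸ p) = dim M`, where the
dimension of `M` is recorded by the natural number `n`. -/
def assh (R : Type u) [CommRing R] (M : Type u) [AddCommGroup M] [Module R M] (n : ℕ) :
    Set (Ideal R) :=
  { p ∈ associatedPrimes R M | ringKrullDim (R ⧸ p) = (n : WithBot (WithTop ℕ)) }

/-- The equivalence relation on ideals of `R` identifying `a` and `b` when the top local
cohomology modules `H^n_a(M)` and `H^n_b(M)` are isomorphic as `R`-modules. -/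
def topLCIsoSetoid (R : Type u) [CommRing R] (M : Type u) [AddCommGroup M] [Module R M]
    (n : ℕ) : Setoid (Ideal R) where
  r a b := Nonempty (((localCohomology a n).obj (ModuleCat.of R M)) ≃ₗ[R]
    ((localCohomology b n).obj (ModuleCat.of R M)))
  iseqv :=
    ⟨fun _ => ⟨LinearEquiv.refl _ _⟩, fun ⟨e⟩ => ⟨e.symm⟩, fun ⟨e⟩ ⟨f⟩ => ⟨e.trans f⟩⟩

section
open CategoryTheory Opposite
namespace LC
variable {R : Type u} [CommRing R]

abbrev yo (Y : ModuleCat.{u} R) := ((linearYoneda R (ModuleCat.{u} R)).obj Y).rightOp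

def yoMapY (K : ChainComplex (ModuleCat.{u} R) ℕ) {Y Y' : ModuleCat.{u} R} (f : Y ⟶ Y') :
    K.linearYonedaObj R Y ⟶ K.linearYonedaObj R Y' :=
  (HomologicalComplex.unopFunctor _ _).map
    ((NatTrans.mapHomologicalComplex (NatTrans.rightOp ((linearYoneda R (ModuleCat.{u} R)).map f)) _).app K).op

def yoMapX {K K' : ChainComplex (ModuleCat.{u} R) ℕ} (φ : K ⟶ K') (Y : ModuleCat.{u} R) :
    K'.linearYonedaObj R Y ⟶ K.linearYonedaObj R Y :=
  (HomologicalComplex.unopFunctor _ _).map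
    (((yo Y).mapHomologicalComplex _).map φ).op

lemma unop_nat {c : ComplexShape ℕ} {K L : HomologicalComplex (ModuleCat.{u} R)ᵒᵖ c} (φ : K ⟶ L) (n : ℕ) :
    (L.homologyUnop n).hom ≫ (HomologicalComplex.homologyMap φ n).unop =
      HomologicalComplex.homologyMap ((HomologicalComplex.unopFunctor _ _).map φ.op) n ≫ (K.homologyUnop n).hom := by
  have := HomologicalComplex.homologyOp_hom_naturality ((HomologicalComplex.unopFunctor _ _).map φ.op) n
  apply Quiver.Hom.op_inj
  exact this

section abs
variable {C : Type*} [Category C]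
lemma abs1 {A B D A' B' D' : C} {p : A ⟶ B} {q : B ⟶ D} {r : D ⟶ D'} {p' : A' ⟶ B'} {q' : B' ⟶ D'}
    {x : A ⟶ A'} {y : B ⟶ B'} (h1 : q ≫ r = y ≫ q') (h2 : p ≫ y = x ≫ p') :
    (p ≫ q) ≫ r = x ≫ (p' ≫ q') := by
  rw [Category.assoc, h1, ← Category.assoc, h2, Category.assoc]
end abs

def extInv {X : ModuleCat.{u} R} (P : ProjectiveResolution X) (n : ℕ) (Y : ModuleCat.{u} R) :
    (P.complex.linearYonedaObj R Y).homology n ≅ ((Ext R (ModuleCat.{u} R) n).obj (op X)).obj Y :=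
  ((((yo Y).mapHomologicalComplex _).obj P.complex |>.homologyUnop n)) ≪≫
    (P.isoLeftDerivedObj (yo Y) n).unop

lemma extInv_natX {X X' : ModuleCat.{u} R} (P : ProjectiveResolution X) (P' : ProjectiveResolution X')
    (g : X ⟶ X') (φ : P.complex ⟶ P'.complex) (comm : φ.f 0 ≫ P'.π.f 0 = P.π.f 0 ≫ g)
    (n : ℕ) (Y : ModuleCat.{u} R) :
    (extInv P' n Y).hom ≫ ((Ext R (ModuleCat.{u} R) n).map g.op).app Y =
      HomologicalComplex.homologyMap (yoMapX φ Y) n ≫ (extInv P n Y).hom := by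
  have h := ProjectiveResolution.isoLeftDerivedObj_hom_naturality g P P' φ comm (yo Y) n
  have h2 := congrArg Quiver.Hom.unop h
  have h3 := unop_nat (((yo Y).mapHomologicalComplex _).map φ) n
  exact abs1 h2 h3

lemma extInv_natY {X : ModuleCat.{u} R} (P : ProjectiveResolution X) (n : ℕ) {Y Y' : ModuleCat.{u} R} (f : Y ⟶ Y') :
    (extInv P n Y).hom ≫ ((Ext R (ModuleCat.{u} R) n).obj (op X)).map f =
      HomologicalComplex.homologyMap (yoMapY P.complex f) n ≫ (extInv P n Y').hom := by
  have h3 := unop_nat ((NatTrans.mapHomologicalComplex (NatTrans.rightOp ((linearYoneda R (ModuleCat.{u} R)).map f)) _).app P.complex) n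
  have h4 : (P.isoLeftDerivedObj (yo Y) n).hom.unop ≫ ((NatTrans.leftDerived (NatTrans.rightOp ((linearYoneda R (ModuleCat.{u} R)).map f)) n).app X).unop =
     (HomologicalComplex.homologyMap ((NatTrans.mapHomologicalComplex (NatTrans.rightOp ((linearYoneda R (ModuleCat.{u} R)).map f)) _).app P.complex) n).unop ≫ (P.isoLeftDerivedObj (yo Y') n).hom.unop := by
    apply Quiver.Hom.op_inj
    have h := ProjectiveResolution.leftDerived_app_eq (NatTrans.rightOp ((linearYoneda R (ModuleCat.{u} R)).map f)) P n
    have h' := congrArg (· ≫ (P.isoLeftDerivedObj (yo Y) n).hom) h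
    simp only [Category.assoc, Iso.inv_hom_id, Category.comp_id] at h'
    exact h'
  exact abs1 h4 h3
end LC
end

section
open CategoryTheory Opposite
namespace LC
variable {R : Type u} [CommRing R]

def hcl (K : CochainComplex (ModuleCat.{u} R) ℕ) (n : ℕ) :
    LinearMap.ker (K.d n (n+1)).hom →ₗ[R] K.homology n :=
  (K.liftCycles (A := ModuleCat.of R (LinearMap.ker (K.d n (n+1)).hom)) (ModuleCat.ofHom (Submodule.subtype _)) (n+1) (by simp) (by ext x; exact x.2)
    ≫ K.homologyπ n).hom

lemma hcl_i (K : CochainComplex (ModuleCat.{u} R) ℕ) (n : ℕ) (x : K.cycles n) :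
    K.homologyπ n x = hcl K n ⟨K.iCycles n x, by
      have := K.iCycles_d n (n+1)
      exact congrArg (fun f => f.hom x) this⟩ := by
  unfold hcl
  simp only [ModuleCat.hom_comp, LinearMap.comp_apply]
  congr 1
  have hm : Mono (K.iCycles n) := inferInstance
  apply (ModuleCat.mono_iff_injective _).1 hm
  have := K.liftCycles_i (A := ModuleCat.of R (LinearMap.ker (K.d n (n+1)).hom)) (ModuleCat.ofHom (Submodule.subtype _)) (n+1) (by simp) (by ext x; exact x.2)
  have hx : (K.d n (n+1)).hom (K.iCycles n x) = 0 := by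
    have := K.iCycles_d n (n+1)
    exact congrArg (fun f => f.hom x) this
  exact (congrArg (fun f => f.hom ⟨K.iCycles n x, hx⟩) this).symm

lemma hcl_surj (K : CochainComplex (ModuleCat.{u} R) ℕ) (n : ℕ) : Function.Surjective (hcl K n) := by
  intro y
  obtain ⟨x, rfl⟩ := (ModuleCat.epi_iff_surjective (K.homologyπ n)).1 inferInstance y
  exact ⟨_, (hcl_i K n x).symm⟩

lemma hcl_nat {K K' : CochainComplex (ModuleCat.{u} R) ℕ} (φ : K ⟶ K') (n : ℕ) (z) (hz) (hz') :
    HomologicalComplex.homologyMap φ n (hcl K n ⟨z, hz⟩) = hcl K' n ⟨φ.f n z, hz'⟩ := by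
  unfold hcl
  simp only [ModuleCat.hom_comp, LinearMap.comp_apply]
  have h1 := HomologicalComplex.homologyπ_naturality φ n
  have h2 := fun x => congrArg (fun f => f.hom x) h1
  simp only [ModuleCat.hom_comp, LinearMap.comp_apply] at h2
  rw [h2]
  congr 1
  have hm : Mono (K'.iCycles n) := inferInstance
  apply (ModuleCat.mono_iff_injective _).1 hm
  have h3 := K.liftCycles_i (A := ModuleCat.of R (LinearMap.ker (K.d n (n+1)).hom)) (ModuleCat.ofHom (Submodule.subtype _)) (n+1) (by simp) (by ext x; exact x.2)
  have h4 := K'.liftCycles_i (A := ModuleCat.of R (LinearMap.ker (K'.d n (n+1)).hom)) (ModuleCat.ofHom (Submodule.subtype _)) (n+1) (by simp) (by ext x; exact x.2)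
  have h5 := HomologicalComplex.cyclesMap_i φ n
  have h3' := (congrArg (fun f => f.hom ⟨z, hz⟩) h3)
  have h4' := (congrArg (fun f => f.hom ⟨φ.f n z, hz'⟩) h4)
  have h5' := fun x => (congrArg (fun f => f.hom x) h5)
  simp only [ModuleCat.hom_comp, LinearMap.comp_apply] at h3' h4' h5'
  refine (h5' _).trans (Eq.trans ?_ h4'.symm)
  rw [h3']
  rfl

lemma hcl_zero (K : CochainComplex (ModuleCat.{u} R) ℕ) (n : ℕ) (z) (hz) :
    hcl K n ⟨z, hz⟩ = 0 ↔ ∃ j w, K.d j n w = z := by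
  have key : ∀ j, K.toCycles j n ≫ K.iCycles n = K.d j n := fun j => K.toCycles_i j n
  have hm : Mono (K.iCycles n) := inferInstance
  have hinj := (ModuleCat.mono_iff_injective _).1 hm
  have h3 := K.liftCycles_i (A := ModuleCat.of R (LinearMap.ker (K.d n (n+1)).hom)) (ModuleCat.ofHom (Submodule.subtype _)) (n+1) (by simp) (by ext x; exact x.2)
  have h3' := (congrArg (fun f => f.hom ⟨z, hz⟩) h3)
  simp only [ModuleCat.hom_comp, LinearMap.comp_apply] at h3'
  have hk : ∀ j w, K.iCycles n (K.toCycles j n w) = K.d j n w := fun j w => by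
    have := congrArg (fun f => f.hom w) (key j)
    exact this
  constructor
  · intro h
    have hex : (ShortComplex.mk (K.toCycles ((ComplexShape.up ℕ).prev n) n) (K.homologyπ n) (by simp)).Exact :=
      ShortComplex.exact_of_g_is_cokernel _ (K.homologyIsCokernel _ n rfl)
    rw [ShortComplex.moduleCat_exact_iff] at hex
    obtain ⟨w, hw⟩ := hex _ h
    refine ⟨_, w, ?_⟩
    rw [← hk]
    exact (congrArg (K.iCycles n) hw).trans h3'
  · rintro ⟨j, w, h⟩
    have : K.toCycles j n w = (K.liftCycles (A := ModuleCat.of R (LinearMap.ker (K.d n (n+1)).hom)) (ModuleCat.ofHom (Submodule.subtype _)) (n+1) (by simp) (by ext x; exact x.2)) ⟨z,hz⟩ := by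
      apply hinj
      rw [hk, h]
      exact h3'.symm
    have h5 := congrArg (fun f => f.hom w) (K.toCycles_comp_homologyπ j n)
    simp only [ModuleCat.hom_comp, LinearMap.comp_apply] at h5
    unfold hcl
    simp only [ModuleCat.hom_comp, LinearMap.comp_apply]
    exact (congrArg _ this.symm).trans h5

variable {X X' : ModuleCat.{u} R}

/-- class in Ext of a cocycle -/
def ecl (P : ProjectiveResolution X) (n : ℕ) (Y : ModuleCat.{u} R) (z : P.complex.X n ⟶ Y)
    (hz : P.complex.d (n+1) n ≫ z = 0) : ((Ext R (ModuleCat.{u} R) n).obj (op X)).obj Y :=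
  (extInv P n Y).hom (hcl (P.complex.linearYonedaObj R Y) n ⟨z, hz⟩)

lemma ecl_add (P : ProjectiveResolution X) (n : ℕ) (Y : ModuleCat.{u} R) (z z' : P.complex.X n ⟶ Y) (hz hz' h):
   ecl P n Y (z + z') h = ecl P n Y z hz + ecl P n Y z' hz' := by
  unfold ecl
  rw [← map_add, ← map_add]
  rfl

lemma ecl_smul (P : ProjectiveResolution X) (n : ℕ) (Y : ModuleCat.{u} R) (r : R) (z : P.complex.X n ⟶ Y) (hz h):
   ecl P n Y (r • z) h = r • ecl P n Y z hz := by
  unfold ecl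
  rw [← map_smul, ← map_smul]
  rfl

lemma ecl_surj (P : ProjectiveResolution X) (n : ℕ) (Y : ModuleCat.{u} R) (x : ((Ext R (ModuleCat.{u} R) n).obj (op X)).obj Y) :
    ∃ z hz, ecl P n Y z hz = x := by
  obtain ⟨y, rfl⟩ := (ModuleCat.epi_iff_surjective (extInv P n Y).hom).1 inferInstance x
  obtain ⟨⟨z, hz⟩, rfl⟩ := hcl_surj _ _ y
  exact ⟨z, hz, rfl⟩

lemma ecl_zero (P : ProjectiveResolution X) (n : ℕ) (Y : ModuleCat.{u} R) (z : P.complex.X n ⟶ Y) (hz) :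
    ecl P n Y z hz = 0 ↔ ∃ (j : ℕ) (w : P.complex.X j ⟶ Y), P.complex.d n j ≫ w = z := by
  have hi := (ModuleCat.mono_iff_injective (extInv P n Y).hom).1 inferInstance
  exact (map_eq_zero_iff _ hi).trans (hcl_zero (P.complex.linearYonedaObj R Y) n z hz)

lemma ecl_natX (P : ProjectiveResolution X) (P' : ProjectiveResolution X') (n : ℕ) (Y : ModuleCat.{u} R)
    (g : X ⟶ X') (φ : P.complex ⟶ P'.complex) (comm : φ.f 0 ≫ P'.π.f 0 = P.π.f 0 ≫ g) (z) (hz) (hz') :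
    ((Ext R (ModuleCat.{u} R) n).map g.op).app Y (ecl P' n Y z hz) = ecl P n Y (φ.f n ≫ z) hz' := by
  have h := fun x => congrArg (fun f => f.hom x) (extInv_natX P P' g φ comm n Y)
  simp only [ModuleCat.hom_comp, LinearMap.comp_apply] at h
  exact (h _).trans (congrArg _ (hcl_nat (yoMapX φ Y) n z hz hz'))

lemma ecl_natY (P : ProjectiveResolution X) (n : ℕ) {Y Y' : ModuleCat.{u} R} (f : Y ⟶ Y')
    (z) (hz) (hz') :
    ((Ext R (ModuleCat.{u} R) n).obj (op X)).map f (ecl P n Y z hz) = ecl P n Y' (z ≫ f) hz' := by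
  have h := fun x => congrArg (fun f => f.hom x) (extInv_natY P n f)
  simp only [ModuleCat.hom_comp, LinearMap.comp_apply] at h
  exact (h _).trans (congrArg _ (hcl_nat (yoMapY P.complex f) n z hz hz'))
end LC
end

section
open CategoryTheory Opposite Limits
namespace LC
variable {R : Type u} [CommRing R]

abbrev Q (a : Ideal R) (t : ℕ) : ModuleCat.{u} R := ModuleCat.of R (R ⧸ a ^ t)

def qmap (a : Ideal R) {t s : ℕ} (h : t ≤ s) : Q a s ⟶ Q a t :=
  ModuleCat.ofHom (Submodule.mapQ _ _ LinearMap.id (Ideal.pow_le_pow_right h))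

def PP (a : Ideal R) (t : ℕ) : ProjectiveResolution (Q a t) := projectiveResolution _

abbrev PC (a : Ideal R) (t : ℕ) := (PP a t).complex

def tr (a : Ideal R) {t s : ℕ} (h : t ≤ s) : PC a s ⟶ PC a t :=
  ProjectiveResolution.lift (qmap a h) _ _

lemma tr_zero (a : Ideal R) {t s : ℕ} (h : t ≤ s) : (tr a h).f 0 ≫ (PP a t).π.f 0 = (PP a s).π.f 0 ≫ qmap a h := by
  have := ProjectiveResolution.lift_commutes_zero (qmap a h) (PP a s) (PP a t)
  exact this

abbrev H (a : Ideal R) (n : ℕ) (Y : ModuleCat.{u} R) : ModuleCat.{u} R := (localCohomology a n).obj Y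

def cc (a : Ideal R) (n : ℕ) (Y : ModuleCat.{u} R) :
  Cocone (localCohomology.diagram (localCohomology.idealPowersDiagram a) n ⋙ (evaluation _ _).obj Y) :=
   ((evaluation _ _).obj Y).mapCocone (colimit.cocone (localCohomology.diagram (localCohomology.idealPowersDiagram a) n))

def ccc (a : Ideal R) (n : ℕ) (Y : ModuleCat.{u} R) : IsColimit (cc a n Y) :=
  isColimitOfPreserves _ (colimit.isColimit _)

def inc (a : Ideal R) (n t : ℕ) (Y : ModuleCat.{u} R) : ((Ext R (ModuleCat.{u} R) n).obj (op (Q a t))).obj Y ⟶ H a n Y :=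
  (cc a n Y).ι.app (op (op t))

lemma inc_nat (a : Ideal R) (n t : ℕ) {Y Y' : ModuleCat.{u} R} (f : Y ⟶ Y') (x) :
    (localCohomology a n).map f (inc a n t Y x) = inc a n t Y' (((Ext R (ModuleCat.{u} R) n).obj (op (Q a t))).map f x) := by
  have := ((colimit.ι (localCohomology.diagram (localCohomology.idealPowersDiagram a) n) (op (op t))).naturality f)
  exact (congrArg (fun f => f.hom x) this).symm

lemma inc_tr (a : Ideal R) (n : ℕ) {t s : ℕ} (h : t ≤ s) (Y : ModuleCat.{u} R) (x) :
    inc a n t Y x = inc a n s Y (((Ext R (ModuleCat.{u} R) n).map (qmap a h).op).app Y x) := by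
  have := (cc a n Y).w (homOfLE h).op.op
  exact (congrArg (fun f => f.hom x) this).symm

instance pfc : PreservesFilteredColimitsOfSize.{0,0} (forget (ModuleCat.{u} R)) :=
  preservesFilteredColimitsOfSize_shrink.{0,u,0,u} _

instance : IsFiltered ℕᵒᵖᵒᵖ := IsFiltered.of_equivalence (opOpEquivalence ℕ).symm

instance pfcc (F : ℕᵒᵖᵒᵖ ⥤ ModuleCat.{u} R) : PreservesColimit F (forget (ModuleCat.{u} R)) :=
  (PreservesFilteredColimitsOfSize.preserves_filtered_colimits (F := forget (ModuleCat.{u} R)) ℕᵒᵖᵒᵖ).preservesColimit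

lemma inc_surj (a : Ideal R) (n : ℕ) (Y : ModuleCat.{u} R) (x : H a n Y) : ∃ t y, inc a n t Y y = x := by
  obtain ⟨j, y, h⟩ := Concrete.isColimit_exists_rep _ (ccc a n Y) x
  exact ⟨unop (unop j), y, h⟩

lemma gen_zero (F : ℕᵒᵖᵒᵖ ⥤ ModuleCat.{u} R) (c : Cocone F) (hc : IsColimit c) (j : ℕᵒᵖᵒᵖ) (y : F.obj j)
    (h : c.ι.app j y = 0) : ∃ k, ∃ f : j ⟶ k, F.map f y = 0 := by
  have h2 : c.ι.app j y = c.ι.app j 0 := by rw [map_zero]; exact h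
  obtain ⟨k, f, g, h⟩ := Concrete.isColimit_exists_of_rep_eq _ hc y 0 h2
  exact ⟨k, f, h.trans (map_zero _)⟩

lemma inc_zero (a : Ideal R) (n t : ℕ) (Y : ModuleCat.{u} R) (y) (h : inc a n t Y y = 0) :
    ∃ s, ∃ h : t ≤ s, ((Ext R (ModuleCat.{u} R) n).map (qmap a h).op).app Y y = 0 := by
  obtain ⟨k, f, h⟩ := gen_zero _ _ (ccc a n Y) (op (op t)) y h
  exact ⟨unop (unop k), leOfHom f.unop.unop, h⟩

variable {a : Ideal R} {n : ℕ} {Y : ModuleCat.{u} R}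

def cl (t : ℕ) (z : (PC a t).X n ⟶ Y) (hz : (PC a t).d (n+1) n ≫ z = 0) : H a n Y :=
  inc a n t Y (ecl (PP a t) n Y z hz)

lemma cl_congr (t : ℕ) {z z' : (PC a t).X n ⟶ Y} (h : z = z') (hz hz') : cl t z hz = cl t z' hz' := by
  subst h; rfl

lemma cl_add (t : ℕ) (z z' : (PC a t).X n ⟶ Y) (hz hz' h) :
    cl t (z + z') h = cl t z hz + cl t z' hz' := by
  unfold cl; rw [ecl_add _ _ _ _ _ hz hz', map_add]

lemma cl_smul (t : ℕ) (r : R) (z : (PC a t).X n ⟶ Y) (hz h) :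
    cl t (r • z) h = r • cl t z hz := by
  unfold cl; rw [ecl_smul _ _ _ _ _ hz, map_smul]

lemma cl_surj (x : H a n Y) : ∃ t z hz, cl t z hz = x := by
  obtain ⟨t, y, rfl⟩ := inc_surj a n Y x
  obtain ⟨z, hz, rfl⟩ := ecl_surj (PP a t) n Y y
  exact ⟨t, z, hz, rfl⟩

lemma cl_tr {t s : ℕ} (h : t ≤ s) (z : (PC a t).X n ⟶ Y) (hz hz') :
    cl t z hz = cl s ((tr a h).f n ≫ z) hz' := by
  unfold cl
  rw [inc_tr a n h, ecl_natX _ _ _ _ _ (tr a h) (tr_zero a h)]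

lemma tr_cocycle {t s : ℕ} (h : t ≤ s) (z : (PC a t).X n ⟶ Y) (hz : (PC a t).d (n+1) n ≫ z = 0) :
    (PC a s).d (n+1) n ≫ (tr a h).f n ≫ z = 0 := by
  rw [← HomologicalComplex.Hom.comm_assoc, hz, comp_zero]

lemma cl_zero_of (t : ℕ) (z : (PC a t).X n ⟶ Y) (hz) (j : ℕ) (w : (PC a t).X j ⟶ Y) (h : (PC a t).d n j ≫ w = z) : cl t z hz = 0 := by
  unfold cl; rw [(ecl_zero _ _ _ _ _).2 ⟨j, w, h⟩, map_zero]

lemma cl_zero (t : ℕ) (z : (PC a t).X n ⟶ Y) (hz) (h : cl t z hz = 0) :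
    ∃ s, ∃ h : t ≤ s, ∃ j, ∃ w : (PC a s).X j ⟶ Y, (PC a s).d n j ≫ w = (tr a h).f n ≫ z := by
  obtain ⟨s, hs, h1⟩ := inc_zero a n t Y _ h
  rw [ecl_natX _ _ _ _ _ (tr a hs) (tr_zero a hs) _ _ (tr_cocycle hs z hz)] at h1
  exact ⟨s, hs, (ecl_zero _ _ _ _ _).1 h1⟩

lemma cl_map {Y' : ModuleCat.{u} R} (f : Y ⟶ Y') (t : ℕ) (z : (PC a t).X n ⟶ Y) (hz hz') :
    (localCohomology a n).map f (cl t z hz) = cl t (z ≫ f) hz' := by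
  unfold cl; rw [inc_nat, ecl_natY]

end LC
end

section
open CategoryTheory Opposite Limits
namespace LC
variable {R : Type u} [CommRing R]
variable {a : Ideal R} {n : ℕ} {Y : ModuleCat.{u} R}

lemma cl_zero_iff (t : ℕ) (z : (PC a t).X n ⟶ Y) (hz) : cl t z hz = 0 ↔
    ∃ s, ∃ h : t ≤ s, ∃ j, ∃ w : (PC a s).X j ⟶ Y, (PC a s).d n j ≫ w = (tr a h).f n ≫ z := by
  refine ⟨cl_zero t z hz, ?_⟩
  rintro ⟨s, h, j, w, e⟩
  rw [cl_tr h z hz (tr_cocycle h z hz)]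
  exact cl_zero_of _ _ _ j w e

lemma cl_zero' (t : ℕ) (z : (PC a t).X (n+1) ⟶ Y) (hz) (h : cl t z hz = 0) :
    ∃ s, ∃ h : t ≤ s, ∃ w : (PC a s).X n ⟶ Y, (PC a s).d (n+1) n ≫ w = (tr a h).f (n+1) ≫ z := by
  obtain ⟨s, hs, j, w, e⟩ := cl_zero t z hz h
  by_cases hj : j = n
  · subst hj; exact ⟨s, hs, w, e⟩
  · refine ⟨s, hs, 0, ?_⟩
    rw [← e, (PC a s).shape (n+1) j (by simpa using hj), zero_comp, comp_zero]

lemma cl_zero0 (t : ℕ) (z : (PC a t).X 0 ⟶ Y) (hz) (h : cl t z hz = 0) :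
    ∃ s, ∃ h : t ≤ s, (tr a h).f 0 ≫ z = 0 := by
  obtain ⟨s, h, j, w, e⟩ := cl_zero t z hz h
  refine ⟨s, h, ?_⟩
  rw [← e, (PC a s).shape _ _ (by simp)]; simp

section les
variable (a)
variable {S : ShortComplex (ModuleCat.{u} R)} (hS : S.ShortExact)
include hS

lemma lift_g {P : ModuleCat.{u} R} [Projective P] (z : P ⟶ S.X₃) : ∃ w : P ⟶ S.X₂, w ≫ S.g = z :=
  have := hS.epi_g
  ⟨Projective.factorThru z S.g, by simp⟩

lemma lift_f {P : ModuleCat.{u} R} (z : P ⟶ S.X₂) (h : z ≫ S.g = 0) : ∃ w : P ⟶ S.X₁, w ≫ S.f = z :=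
  have := hS.mono_f
  ⟨hS.exact.lift z h, by simp⟩

omit hS in
variable (S) in
def dG (n : ℕ) : Submodule R (H a n S.X₃ × H a (n+1) S.X₁) where
  carrier := { p | ∃ (t : ℕ) (z : (PC a t).X n ⟶ S.X₃) (hz : _) (y : (PC a t).X (n+1) ⟶ S.X₁) (hy : _)
    (z' : (PC a t).X n ⟶ S.X₂), p = (cl t z hz, cl t y hy) ∧ z' ≫ S.g = z ∧ (PC a t).d (n+1) n ≫ z' = y ≫ S.f }
  zero_mem' := ⟨0, 0, by simp, 0, by simp, 0, by
    rw [cl_zero_of 0 0 _ 0 0 (by simp), cl_zero_of 0 0 _ 0 0 (by simp)]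
    exact ⟨rfl, by simp, by simp⟩⟩
  add_mem' := by
    rintro _ _ ⟨t, z, hz, y, hy, z', rfl, h1, h2⟩ ⟨t2, z2, hz2, y2, hy2, z2', rfl, h12, h22⟩
    obtain ⟨s, hs, hs2⟩ : ∃ s, t ≤ s ∧ t2 ≤ s := ⟨max t t2, le_max_left _ _, le_max_right _ _⟩
    refine ⟨s, (tr a hs).f n ≫ z + (tr a hs2).f n ≫ z2, ?_, (tr a hs).f (n+1) ≫ y + (tr a hs2).f (n+1) ≫ y2, ?_, 
      (tr a hs).f n ≫ z' + (tr a hs2).f n ≫ z2', ?_, ?_, ?_⟩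
    · rw [Preadditive.comp_add, tr_cocycle hs _ hz, tr_cocycle hs2 _ hz2, add_zero]
    · rw [Preadditive.comp_add, tr_cocycle hs _ hy, tr_cocycle hs2 _ hy2, add_zero]
    · rw [cl_tr hs z hz (tr_cocycle hs _ hz), cl_tr hs2 z2 hz2 (tr_cocycle hs2 _ hz2),
        cl_tr hs y hy (tr_cocycle hs _ hy), cl_tr hs2 y2 hy2 (tr_cocycle hs2 _ hy2)]
      rw [cl_add _ _ _ (tr_cocycle hs _ hz) (tr_cocycle hs2 _ hz2), cl_add _ _ _ (tr_cocycle hs _ hy) (tr_cocycle hs2 _ hy2)]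
      rfl
    · simp [h1, h12]
    · simp only [Preadditive.comp_add, ← HomologicalComplex.Hom.comm_assoc, h2, h22, Preadditive.add_comp, Category.assoc]
  smul_mem' := by
    rintro r _ ⟨t, z, hz, y, hy, z', rfl, h1, h2⟩
    refine ⟨t, r • z, by simp [hz], r • y, by simp [hy], r • z', ?_, by simp [h1], by simp [h2]⟩
    rw [cl_smul _ _ _ hz, cl_smul _ _ _ hy]
    rfl

lemma dG_ex (n : ℕ) (c : H a n S.X₃) : ∃ α, (c, α) ∈ dG a S n := by
  obtain ⟨t, z, hz, rfl⟩ := cl_surj c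
  obtain ⟨z', h1⟩ := lift_g hS z
  obtain ⟨y, h2⟩ := lift_f hS ((PC a t).d (n+1) n ≫ z') (by rw [Category.assoc, h1, hz])
  have := hS.mono_f
  have hy : (PC a t).d (n+1+1) (n+1) ≫ y = 0 := by
    rw [← cancel_mono S.f, Category.assoc, h2]; simp
  exact ⟨cl t y hy, t, z, hz, y, hy, z', rfl, h1, h2.symm⟩

lemma dG_uniq (n : ℕ) (α) (h : (0, α) ∈ dG a S n) : α = 0 := by
  obtain ⟨t, z, hz, y, hy, z', he, h1, h2⟩ := h
  rw [Prod.mk.injEq] at he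
  obtain ⟨he1, rfl⟩ := he
  obtain ⟨s, hs, j, w, hw⟩ := cl_zero t z hz he1.symm
  obtain ⟨w', hw'⟩ := lift_g hS w
  obtain ⟨v, hv⟩ := lift_f hS ((tr a hs).f n ≫ z' - (PC a s).d n j ≫ w') (by
    simp [hw', h1, hw])
  have := hS.mono_f
  rw [cl_tr hs y hy (tr_cocycle hs _ hy)]
  apply cl_zero_of _ _ _ n v
  rw [← cancel_mono S.f, Category.assoc, hv]
  simp [← h2]

lemma dG_eq (n : ℕ) (c α β) (h : (c, α) ∈ dG a S n) (h' : (c, β) ∈ dG a S n) : α = β := by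
  have := (dG a S n).sub_mem h h'
  rw [Prod.mk_sub_mk, sub_self] at this
  exact sub_eq_zero.1 (dG_uniq a hS n _ this)

lemma ex_δ (n : ℕ) : ∃ δ : H a n S.X₃ →ₗ[R] H a (n+1) S.X₁, dG a S n = δ.graph := by
  apply Submodule.exists_eq_graph
  constructor
  · rintro ⟨⟨c, α⟩, h⟩ ⟨⟨c', β⟩, h'⟩ e
    change c = c' at e
    subst e
    have := dG_eq a hS n c α β h h'
    subst this; rfl
  · intro c
    obtain ⟨α, h⟩ := dG_ex a hS n c
    exact ⟨⟨_, h⟩, rfl⟩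

/-- the long exact sequence -/
lemma les (n : ℕ) : ∃ δ : H a n S.X₃ →ₗ[R] H a (n+1) S.X₁,
    (∀ c, δ c = 0 ↔ ∃ b, (localCohomology a n).map S.g b = c) ∧
    (∀ α, (localCohomology a (n+1)).map S.f α = 0 ↔ ∃ c, δ c = α) := by
  obtain ⟨δ, hδ⟩ := ex_δ a hS n
  have key : ∀ c α, (c, α) ∈ dG a S n ↔ α = δ c := fun c α => by rw [hδ, LinearMap.mem_graph_iff]
  refine ⟨δ, ?_, ?_⟩
  · intro c
    constructor
    · intro h
      obtain ⟨t, z, hz, y, hy, z', he, h1, h2⟩ := (key c 0).2 h.symm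
      rw [Prod.mk.injEq] at he
      obtain ⟨rfl, he1⟩ := he
      obtain ⟨s, hs, w, hw⟩ := cl_zero' t y hy he1.symm
      have hc : (PC a s).d (n+1) n ≫ ((tr a hs).f n ≫ z' - w ≫ S.f) = 0 := by
        rw [Preadditive.comp_sub, ← HomologicalComplex.Hom.comm_assoc, h2, reassoc_of% hw, sub_self]
      refine ⟨cl s ((tr a hs).f n ≫ z' - w ≫ S.f) hc, ?_⟩
      rw [cl_map _ _ _ _ (by rw [reassoc_of% hc, zero_comp]), cl_tr hs z hz (tr_cocycle hs _ hz)]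
      apply cl_congr
      simp [h1]
    · rintro ⟨b, rfl⟩
      obtain ⟨t, z, hz, rfl⟩ := cl_surj b
      symm
      rw [← key]
      refine ⟨t, z ≫ S.g, by rw [reassoc_of% hz, zero_comp], 0, by simp, z, ?_, rfl, by simp [hz]⟩
      rw [cl_map _ _ _ _ (by rw [reassoc_of% hz, zero_comp]), cl_zero_of t 0 (by simp) 0 0 (by simp)]
  · intro α
    constructor
    · intro h
      obtain ⟨t, y, hy, rfl⟩ := cl_surj α
      rw [cl_map _ _ _ _ (by rw [reassoc_of% hy, zero_comp])] at h
      obtain ⟨s, hs, w, hw⟩ := cl_zero' _ _ _ h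
      refine ⟨cl s (w ≫ S.g) (by rw [reassoc_of% hw]; simp), ?_⟩
      symm
      rw [← key]
      refine ⟨s, _, by rw [reassoc_of% hw]; simp, (tr a hs).f (n+1) ≫ y, tr_cocycle hs _ hy, w, ?_, rfl, by rw [hw, Category.assoc]⟩
      rw [cl_tr hs y hy (tr_cocycle hs _ hy)]
    · rintro ⟨c, rfl⟩
      obtain ⟨t, z, hz, y, hy, z', he, h1, h2⟩ := (key c _).2 rfl
      rw [Prod.mk.injEq] at he
      rw [he.2, cl_map _ _ _ _ (by rw [reassoc_of% hy, zero_comp])]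
      exact cl_zero_of _ _ _ n z' h2

lemma les_mid (n : ℕ) (b : H a n S.X₂) : (localCohomology a n).map S.g b = 0 ↔ ∃ x, (localCohomology a n).map S.f x = b := by
  constructor
  · intro h
    obtain ⟨t, z, hz, rfl⟩ := cl_surj b
    rw [cl_map _ _ _ _ (by rw [reassoc_of% hz, zero_comp])] at h
    obtain ⟨s, hs, j, w, hw⟩ := cl_zero _ _ _ h
    obtain ⟨w', hw'⟩ := lift_g hS w
    obtain ⟨v, hv⟩ := lift_f hS ((tr a hs).f n ≫ z - (PC a s).d n j ≫ w') (by
      simp [hw', hw])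
    have := hS.mono_f
    have hvc : (PC a s).d (n+1) n ≫ v = 0 := by
      rw [← cancel_mono S.f, Category.assoc, hv, Preadditive.comp_sub, tr_cocycle hs z hz]; simp
    refine ⟨cl s v hvc, ?_⟩
    rw [cl_map _ _ _ _ (by rw [reassoc_of% hvc, zero_comp]), cl_tr hs z hz (tr_cocycle hs _ hz)]
    have e : (tr a hs).f n ≫ z = v ≫ S.f + (PC a s).d n j ≫ w' := by rw [hv]; abel
    rw [cl_congr s e _ (by rw [← e]; exact tr_cocycle hs _ hz), cl_add _ _ _ (by rw [reassoc_of% hvc, zero_comp]) (by simp),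
      cl_zero_of s ((PC a s).d n j ≫ w') _ j w' rfl, add_zero]
  · rintro ⟨x, rfl⟩
    obtain ⟨t, z, hz, rfl⟩ := cl_surj x
    rw [cl_map _ _ _ _ (by rw [reassoc_of% hz, zero_comp]), cl_map _ _ _ _ (by simp)]
    exact cl_zero_of _ _ _ 0 0 (by simp)

lemma les_zero (x : H a 0 S.X₁) (h : (localCohomology a 0).map S.f x = 0) : x = 0 := by
  obtain ⟨t, z, hz, rfl⟩ := cl_surj x
  rw [cl_map _ _ _ _ (by rw [reassoc_of% hz, zero_comp])] at h
  obtain ⟨s, hs, hw⟩ := cl_zero0 _ _ _ h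
  have := hS.mono_f
  rw [cl_tr hs z hz (tr_cocycle hs _ hz)]
  apply cl_zero_of _ _ _ 0 0
  rw [comp_zero, ← cancel_mono S.f, zero_comp, Category.assoc, hw]
end les

lemma map_lin {Y' : ModuleCat.{u} R} (f g : Y ⟶ Y') (r : R) (x : H a n Y) :
   (localCohomology a n).map (r • f + g) x = r • (localCohomology a n).map f x + (localCohomology a n).map g x := by
  obtain ⟨t, z, hz, rfl⟩ := cl_surj x
  have h : ∀ {Y' : ModuleCat.{u} R} (f : Y ⟶ Y'), (PC a t).d (n+1) n ≫ z ≫ f = 0 := fun f => by rw [reassoc_of% hz, zero_comp]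
  rw [cl_map _ _ _ _ (h _), cl_map _ _ _ _ (h _), cl_map _ _ _ _ (h _), ← cl_smul _ _ _ _ (by simp [h]),
    ← cl_add _ _ _ _ _ (by simp [h])]
  exact cl_congr _ (by simp) _ _

lemma inj_vanish [Injective Y] (x : H a (n+1) Y) : x = 0 := by
  obtain ⟨t, z, hz, rfl⟩ := cl_surj x
  exact cl_zero_of _ _ _ n (((PP a t).exact_succ n).descToInjective z hz) (((PP a t).exact_succ n).comp_descToInjective z hz)

lemma ecl_kill {X : ModuleCat.{u} R} (P : ProjectiveResolution X) (r : R) (hr : r • 𝟙 X = 0) (z hz) :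
    r • ecl P n Y z hz = 0 := by
  have h1 := ecl_natX P P n Y (r • 𝟙 X) (r • 𝟙 _) ((Linear.smul_comp _ _ _ _ _ _).trans ((congrArg (r • ·) ((Category.id_comp _).trans (Category.comp_id _).symm)).trans (Linear.comp_smul _ _ _ _ _ _).symm)) z hz (by simp [hz])
  have h2 := ecl_natX P P n Y (r • 𝟙 X) 0 (by rw [hr]; exact zero_comp.trans comp_zero.symm) z hz (by simp)
  rw [h1] at h2
  have h3 : ecl P n Y (r • z) (by simp [hz]) = ecl P n Y 0 (by simp) := by
    convert h2 using 2 <;> simp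
  rw [← ecl_smul P n Y r z hz (by simp [hz]), h3]
  exact (ecl_zero _ _ _ _ _).2 ⟨0, 0, by simp⟩

lemma tors (x : H a n Y) : ∃ t : ℕ, ∀ r ∈ a ^ t, r • x = 0 := by
  obtain ⟨t, z, hz, rfl⟩ := cl_surj x
  refine ⟨t, fun r hr => ?_⟩
  unfold cl
  rw [← map_smul, ecl_kill, map_zero]
  apply ModuleCat.hom_ext
  apply LinearMap.ext
  intro x
  obtain ⟨x, rfl⟩ := Submodule.Quotient.mk_surjective _ x
  change r • (Submodule.Quotient.mk x : R ⧸ a ^ t) = 0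
  rw [← Submodule.Quotient.mk_smul, Submodule.Quotient.mk_eq_zero]
  exact Ideal.mul_mem_right _ _ hr
end LC
end

section
open CategoryTheory Opposite Limits
namespace LC
variable {R : Type u} [CommRing R]

def gam (a : Ideal R) (M : Type*) [AddCommGroup M] [Module R M] : Submodule R M where
  carrier := {y | ∃ t : ℕ, ∀ r ∈ a ^ t, r • y = 0}
  zero_mem' := ⟨0, by simp⟩
  add_mem' := by
    rintro x y ⟨t, ht⟩ ⟨s, hs⟩
    refine ⟨max t s, fun r hr => ?_⟩
    rw [smul_add, ht r (Ideal.pow_le_pow_right (le_max_left _ _) hr), hs r (Ideal.pow_le_pow_right (le_max_right _ _) hr), add_zero]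
  smul_mem' := by
    rintro c x ⟨t, ht⟩
    exact ⟨t, fun r hr => by rw [smul_comm, ht r hr, smul_zero]⟩

section
variable {a : Ideal R} {Y : ModuleCat.{u} R}
def pi0 (a : Ideal R) (t : ℕ) : (PC a t).X 0 ⟶ Q a t := (PP a t).π.f 0

lemma d_pi0 (t : ℕ) : (PC a t).d (0+1) 0 ≫ pi0 a t = 0 := (PP a t).complex_d_comp_π_f_zero
lemma pi0_surj (t : ℕ) : Function.Surjective (pi0 a t) := by
  apply (ModuleCat.epi_iff_surjective _).1
  exact inferInstanceAs (Epi ((PP a t).π.f 0))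
lemma pi0_tr {t s : ℕ} (h : t ≤ s) : (tr a h).f 0 ≫ pi0 a t = pi0 a s ≫ qmap a h := tr_zero a h
lemma pi0_desc (t : ℕ) (z : (PC a t).X 0 ⟶ Y) (hz : (PC a t).d (0+1) 0 ≫ z = 0) : ∃ h, pi0 a t ≫ h = z :=
  ⟨_, (CokernelCofork.IsColimit.desc' (PP a t).isColimitCokernelCofork z hz).2⟩

def one (a : Ideal R) (t : ℕ) : Q a t := (Submodule.Quotient.mk (1 : R) : R ⧸ a ^ t)

lemma one_q {t s : ℕ} (h : t ≤ s) : qmap a h (one a s) = one a t := rfl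

lemma hom_one {t : ℕ} (h h' : Q a t ⟶ Y) (e : h (one a t) = h' (one a t)) : h = h' := by
  apply ModuleCat.hom_ext
  apply LinearMap.ext
  intro x
  obtain ⟨x, rfl⟩ := Submodule.Quotient.mk_surjective _ x
  have : (Submodule.Quotient.mk x : R ⧸ a ^ t) = x • one a t := by
    change _ = x • (Submodule.Quotient.mk (1 : R) : R ⧸ a ^ t)
    rw [← Submodule.Quotient.mk_smul, smul_eq_mul, mul_one]
  rw [this, map_smul, map_smul]
  exact congrArg _ e

lemma one_kill {t : ℕ} (r : R) (hr : r ∈ a ^ t) : r • one a t = 0 := by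
    change r • (Submodule.Quotient.mk (1 : R) : R ⧸ a ^ t) = 0
    rw [← Submodule.Quotient.mk_smul, smul_eq_mul, mul_one]
    rwa [Submodule.Quotient.mk_eq_zero]

lemma hom_ex {t : ℕ} (y : Y) (hy : ∀ r ∈ a ^ t, r • y = 0) : ∃ h : Q a t ⟶ Y, h (one a t) = y := by
  refine ⟨ModuleCat.ofHom (Submodule.liftQ _ (LinearMap.toSpanSingleton R Y y) ?_), ?_⟩
  · intro r hr; exact hy r hr
  · exact one_smul _ _

lemma c_pi {t : ℕ} (h : Q a t ⟶ Y) : (PC a t).d (0+1) 0 ≫ pi0 a t ≫ h = 0 := by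
  rw [reassoc_of% (d_pi0 (a := a) t), zero_comp]

lemma cl_pi_tr {t s : ℕ} (hs : t ≤ s) (h : Q a t ⟶ Y) : cl t (pi0 a t ≫ h) (c_pi h) = cl s (pi0 a s ≫ qmap a hs ≫ h) (c_pi _) := by
  rw [cl_tr hs _ (c_pi h) (tr_cocycle hs _ (c_pi h))]
  exact cl_congr _ (by rw [reassoc_of% (pi0_tr (a := a) hs)]) _ _

def evG (a : Ideal R) (Y : ModuleCat.{u} R) : Submodule R (H a 0 Y × Y) where
  carrier := {p | ∃ (t : ℕ) (h : Q a t ⟶ Y), p = (cl t (pi0 a t ≫ h) (c_pi h), h (one a t))}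
  zero_mem' := ⟨0, 0, by rw [cl_zero_of _ _ _ 0 0 (by simp)]; rfl⟩
  add_mem' := by
    rintro _ _ ⟨t, h, rfl⟩ ⟨t2, h2, rfl⟩
    obtain ⟨s, hs, hs2⟩ : ∃ s, t ≤ s ∧ t2 ≤ s := ⟨max t t2, le_max_left _ _, le_max_right _ _⟩
    refine ⟨s, qmap a hs ≫ h + qmap a hs2 ≫ h2, ?_⟩
    rw [cl_pi_tr hs, cl_pi_tr hs2, Prod.mk_add_mk, ← cl_add _ _ _ _ _ (by rw [← Preadditive.comp_add]; exact c_pi _), Prod.mk.injEq]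
    refine ⟨cl_congr _ (by simp) _ _, rfl⟩
  smul_mem' := by
    rintro r _ ⟨t, h, rfl⟩
    refine ⟨t, r • h, ?_⟩
    rw [Prod.smul_mk, ← cl_smul _ _ _ _ (by rw [← Linear.comp_smul]; exact c_pi _), Prod.mk.injEq]
    refine ⟨cl_congr _ (by simp) _ _, rfl⟩

lemma ex_ev (a : Ideal R) (Y : ModuleCat.{u} R) : ∃ e : H a 0 Y →ₗ[R] Y, evG a Y = e.graph := by
  apply Submodule.exists_eq_graph
  constructor
  · change Function.Injective (LinearMap.fst R (H a 0 Y) Y ∘ₗ (evG a Y).subtype)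
    rw [injective_iff_map_eq_zero]
    rintro ⟨p, ⟨t, h, rfl⟩⟩ e
    change cl t (pi0 a t ≫ h) (c_pi h) = 0 at e
    obtain ⟨s, hs, hw⟩ := cl_zero0 _ _ _ e
    rw [reassoc_of% (pi0_tr (a := a) hs)] at hw
    have : h (one a t) = 0 := by
      obtain ⟨p, hp⟩ := pi0_surj s (one a s)
      have := congrArg (fun f => f.hom p) hw
      change h (qmap a hs (pi0 a s p)) = 0 at this
      rwa [hp, one_q] at this
    apply Subtype.ext
    exact Prod.ext e this
  · intro c
    obtain ⟨t, z, hz, rfl⟩ := cl_surj c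
    obtain ⟨h, rfl⟩ := pi0_desc t z hz
    exact ⟨⟨_, ⟨t, h, rfl⟩⟩, rfl⟩
end

section api
variable (a : Ideal R) (n : ℕ) (M N K : Type u) [AddCommGroup M] [Module R M] [AddCommGroup N] [Module R N]
  [AddCommGroup K] [Module R K]

/-- local cohomology, unbundled -/
abbrev HH : Type u := (localCohomology a n).obj (ModuleCat.of R M)

variable {M N K}
def hm (f : M →ₗ[R] N) : HH a n M →ₗ[R] HH a n N := ((localCohomology a n).map (ModuleCat.ofHom f)).hom

lemma hm_id : hm a n (LinearMap.id : M →ₗ[R] M) = LinearMap.id := by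
  unfold hm
  rw [ModuleCat.ofHom_id, CategoryTheory.Functor.map_id]; rfl

lemma hm_comp (g : N →ₗ[R] K) (f : M →ₗ[R] N) : hm a n (g ∘ₗ f) = hm a n g ∘ₗ hm a n f := by
  unfold hm
  rw [ModuleCat.ofHom_comp, Functor.map_comp]; rfl

lemma hm_lin (r : R) (f g : M →ₗ[R] N) : hm a n (r • f + g) = r • hm a n f + hm a n g := by
  apply LinearMap.ext
  intro x
  exact map_lin (ModuleCat.ofHom f) (ModuleCat.ofHom g) r x

lemma hm_zero : hm a n (0 : M →ₗ[R] N) = 0 := by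
  have := hm_lin a n 1 (0 : M →ₗ[R] N) 0
  simpa using this

lemma hm_smul (r : R) (f : M →ₗ[R] N) : hm a n (r • f) = r • hm a n f := by
  simpa [hm_zero] using hm_lin a n r f 0

def hme (e : M ≃ₗ[R] N) : HH a n M ≃ₗ[R] HH a n N :=
  LinearEquiv.ofLinearMap (hm a n e) (hm a n e.symm)
    (by rw [← hm_comp]; simp [hm_id]) (by rw [← hm_comp]; simp [hm_id])

lemma HH_sub [Subsingleton M] : Subsingleton (HH a n M) := by
  have h : (LinearMap.id : M →ₗ[R] M) = 0 := Subsingleton.elim _ _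
  have h2 := hm_id a n (M := M)
  rw [h, hm_zero] at h2
  exact ⟨fun x y => by
    have := LinearMap.congr_fun h2 x; have h3 := LinearMap.congr_fun h2 y
    simp at this h3; rw [← this, ← h3]⟩

lemma HH_tors (x : HH a n M) : ∃ t : ℕ, ∀ r ∈ a ^ t, r • x = 0 := tors x

lemma HH_inj [hM : Module.Injective R M] : Subsingleton (HH a (n+1) M) := by
  have : Injective (ModuleCat.of R M) := (Module.injective_iff_injective_object R M).1 hM
  exact ⟨fun x y => (inj_vanish x).trans (inj_vanish y).symm⟩

variable {f : M →ₗ[R] N} {g : N →ₗ[R] K} (hf : Function.Injective f) (hg : Function.Surjective g) (hfg : Function.Exact f g)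
include hf hg hfg

lemma toSE : (ShortComplex.mk (ModuleCat.ofHom f) (ModuleCat.ofHom g) (by
    apply ModuleCat.hom_ext; apply LinearMap.ext; intro x; exact hfg.apply_apply_eq_zero x)).ShortExact where
  exact := by rw [ShortComplex.moduleCat_exact_iff]; intro x hx; exact (hfg x).1 hx
  mono_f := (ModuleCat.mono_iff_injective _).2 hf
  epi_g := (ModuleCat.epi_iff_surjective _).2 hg

lemma les_b : Function.Exact (hm a n f) (hm a n g) := fun y => les_mid a (toSE hf hg hfg) n y

lemma les_i : Function.Injective (hm a 0 f) := by
  rw [injective_iff_map_eq_zero]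
  exact fun x h => les_zero a (toSE hf hg hfg) x h

lemma les_d : ∃ δ : HH a n K →ₗ[R] HH a (n+1) M, Function.Exact (hm a n g) δ ∧ Function.Exact δ (hm a (n+1) f) := by
  obtain ⟨δ, h1, h2⟩ := les a (toSE hf hg hfg) n
  exact ⟨δ, h1, h2⟩
end api

section api2
variable (a : Ideal R) (n : ℕ) (M : Type u) [AddCommGroup M] [Module R M] {N : Type u} [AddCommGroup N] [Module R N]

def ev : HH a 0 M →ₗ[R] M := (ex_ev a (ModuleCat.of R M)).choose

lemma ev_spec (x y) : y = ev a M x ↔ (x, y) ∈ evG a (ModuleCat.of R M) := by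
  have := (ex_ev a (ModuleCat.of R M)).choose_spec
  rw [this]; rfl

lemma ev_inj : Function.Injective (ev a M) := by
  rw [injective_iff_map_eq_zero]
  intro x hx
  obtain ⟨t, h, e⟩ := (ev_spec a M x 0).1 hx.symm
  rw [Prod.mk.injEq] at e
  have : h = 0 := hom_one _ _ (e.2.symm.trans rfl)
  rw [e.1]
  exact cl_zero_of _ _ _ 0 0 (by rw [this]; simp)

lemma ev_range : LinearMap.range (ev a M) = gam a M := by
  ext y
  constructor
  · rintro ⟨x, hx⟩
    obtain ⟨t, h, e⟩ := (ev_spec a M x y).1 hx.symm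
    rw [Prod.mk.injEq] at e
    refine ⟨t, fun r hr => ?_⟩
    rw [e.2]
    refine (map_smul h.hom r (one a t)).symm.trans ?_
    rw [one_kill r hr, map_zero]
  · rintro ⟨t, ht⟩
    obtain ⟨h, hh⟩ := hom_ex (Y := ModuleCat.of R M) (a := a) (t := t) y ht
    refine ⟨cl t (pi0 a t ≫ h) (c_pi h), ?_⟩
    symm
    rw [ev_spec]
    exact ⟨t, h, by rw [hh]⟩

lemma ev_nat (f : M →ₗ[R] N) (x : HH a 0 M) : ev a N (hm a 0 f x) = f (ev a M x) := by
  obtain ⟨t, h, e⟩ := (ev_spec a M x _).1 rfl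
  rw [Prod.mk.injEq] at e
  symm
  rw [ev_spec]
  refine ⟨t, h ≫ ModuleCat.ofHom f, ?_⟩
  rw [Prod.mk.injEq]
  constructor
  · have : hm a 0 f x = (localCohomology a 0).map (ModuleCat.ofHom f) x := rfl
    rw [this, e.1, cl_map _ _ _ _ (by rw [Category.assoc]; exact c_pi _)]
    exact cl_congr _ (by simp) _ _
  · rw [e.2]; rfl

def evE : HH a 0 M ≃ₗ[R] gam a M :=
  (LinearEquiv.ofInjective _ (ev_inj a M)).trans (LinearEquiv.ofEq _ _ (ev_range a M))
end api2
end LC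
end

section
namespace LC
variable {R : Type u} [CommRing R]

section
variable (a : Ideal R) {M N : Type u} [AddCommGroup M] [Module R M] [AddCommGroup N] [Module R N]

lemma fin_tors [Module.Finite R M] (h : gam a M = ⊤) : ∃ t : ℕ, ∀ r ∈ a ^ t, ∀ x : M, r • x = 0 := by
  obtain ⟨S, hS⟩ := (Module.Finite.fg_top : (⊤ : Submodule R M).FG)
  have : ∀ x : M, ∃ t : ℕ, ∀ r ∈ a ^ t, r • x = 0 := fun x => by
    have : x ∈ gam a M := by rw [h]; trivial
    exact this
  choose t ht using this
  refine ⟨S.sup t, fun r hr x => ?_⟩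
  have hx : x ∈ Submodule.span R (S : Set M) := by rw [hS]; trivial
  induction hx using Submodule.span_induction with
  | mem x h => exact ht x r (Ideal.pow_le_pow_right (Finset.le_sup h) hr)
  | zero => simp
  | add x y _ _ h1 h2 => rw [smul_add, h1, h2, add_zero]
  | smul c x _ h => rw [smul_comm, h, smul_zero]

lemma gam_map (f : M →ₗ[R] N) {x : M} (hx : x ∈ gam a M) : f x ∈ gam a N := by
  obtain ⟨t, ht⟩ := hx
  exact ⟨t, fun r hr => by rw [← map_smul, ht r hr, map_zero]⟩

lemma gam_top_of_surj (f : M →ₗ[R] N) (hf : Function.Surjective f) (h : gam a M = ⊤) : gam a N = ⊤ := by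
  rw [eq_top_iff]; rintro y -
  obtain ⟨x, rfl⟩ := hf y
  exact gam_map a f (h ▸ trivial)

lemma gam_top_of_inj (f : M →ₗ[R] N) (hf : Function.Injective f) (h : gam a N = ⊤) : gam a M = ⊤ := by
  rw [eq_top_iff]; rintro y -
  obtain ⟨t, ht⟩ : f y ∈ gam a N := h ▸ trivial
  exact ⟨t, fun r hr => hf (by rw [map_smul, ht r hr, map_zero])⟩

lemma gam_gam : gam a (gam a M) = ⊤ := by
  rw [eq_top_iff]
  rintro ⟨y, t, ht⟩ -
  exact ⟨t, fun r hr => Subtype.ext (ht r hr)⟩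

instance gam_inj [IsNoetherianRing R] [hI : Module.Injective R M] : Module.Injective R (gam a M) := by
  apply Module.Baer.injective
  intro J f
  have h1 : gam a (LinearMap.range f) = ⊤ :=
    gam_top_of_inj a (Submodule.subtype _) (Submodule.injective_subtype _) (gam_gam a)
  obtain ⟨t, ht⟩ := fin_tors a h1
  obtain ⟨k, hk⟩ := Ideal.exists_pow_inf_eq_pow_smul a (M := R) J
  have hk2 := hk (t + k) (by omega)
  have h3 : ∀ x (hx : x ∈ J), x ∈ a ^ (t + k) → f ⟨x, hx⟩ = 0 := by
    intro x hx hxa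
    have : x ∈ a ^ (t + k - k) • (a ^ k • (⊤ : Submodule R R) ⊓ J) := by
      rw [← hk2]; exact ⟨by simpa using hxa, hx⟩
    rw [Nat.add_sub_cancel] at this
    have key : a ^ t • (a ^ k • (⊤ : Submodule R R) ⊓ J) ≤ Submodule.map J.subtype (LinearMap.ker f) := by
      rw [Submodule.smul_le]
      rintro r hr y ⟨-, hy⟩
      refine ⟨r • ⟨y, hy⟩, ?_, rfl⟩
      rw [SetLike.mem_coe, LinearMap.mem_ker, map_smul]
      exact congrArg Subtype.val (ht r hr ⟨f ⟨y, hy⟩, ⟨_, rfl⟩⟩)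
    obtain ⟨⟨y, hy⟩, h5, h6⟩ := key this
    subst h6
    exact h5
  let K : Submodule R J := Submodule.comap J.subtype (a ^ (t + k))
  let i : (J ⧸ K) →ₗ[R] (R ⧸ a ^ (t+k)) := Submodule.mapQ K (a ^ (t+k)) J.subtype le_rfl
  have hi : Function.Injective i := by
    rw [← LinearMap.ker_eq_bot]
    simp only [i, Submodule.mapQ, Submodule.ker_liftQ, LinearMap.ker_comp, Submodule.ker_mkQ]
    exact Submodule.mkQ_map_self K
  let g : (J ⧸ K) →ₗ[R] M := Submodule.liftQ K ((gam a M).subtype ∘ₗ f) (by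
    rintro ⟨x, hx⟩ hxa
    rw [LinearMap.mem_ker, LinearMap.comp_apply, h3 x hx hxa, map_zero])
  obtain ⟨h, hh⟩ := hI.out i hi g
  refine ⟨LinearMap.codRestrict (gam a M) (h ∘ₗ (a ^ (t+k)).mkQ) ?_, ?_⟩
  · intro c
    refine ⟨t + k, fun r hr => ?_⟩
    rw [← map_smul, LinearMap.comp_apply, Submodule.mkQ_apply, (Submodule.Quotient.mk_eq_zero _).2, map_zero]
    exact Ideal.mul_mem_right _ _ hr
  · intro x hx
    apply Subtype.ext
    exact hh (Submodule.Quotient.mk ⟨x, hx⟩)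

variable (M) in
lemma ex_inj : ∃ (E : Type u) (_ : AddCommGroup E) (_ : Module R E) (_ : Module.Injective R E) (f : M →ₗ[R] E),
    Function.Injective f := by
  obtain ⟨⟨J, hJ, f, hf⟩⟩ := CategoryTheory.EnoughInjectives.presentation (ModuleCat.of R M)
  exact ⟨J, inferInstance, inferInstance, (Module.injective_iff_injective_object R J).2 hJ, f.hom,
    (ModuleCat.mono_iff_injective f).1 hf⟩

lemma ex_inj_tors [IsNoetherianRing R] (h : gam a M = ⊤) : ∃ (E : Type u) (_ : AddCommGroup E) (_ : Module R E) (_ : Module.Injective R E) (f : M →ₗ[R] E),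
    Function.Injective f ∧ gam a E = ⊤ := by
  obtain ⟨E, _, _, hE, f, hf⟩ := ex_inj (R := R) M
  refine ⟨gam a E, inferInstance, inferInstance, inferInstance, f.codRestrict _ fun c => gam_map a f (h ▸ trivial), ?_, gam_gam a⟩
  intro x y hxy
  exact hf (congrArg Subtype.val hxy)
end

section
variable (a : Ideal R) (n : ℕ) {A B C : Type u} [AddCommGroup A] [Module R A] [AddCommGroup B] [Module R B] [AddCommGroup C] [Module R C]
variable {f : A →ₗ[R] B} {g : B →ₗ[R] C} (hf : Function.Injective f) (hg : Function.Surjective g) (hfg : Function.Exact f g)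
include hf hg hfg

lemma les_surj (h : Subsingleton (HH a (n+1) A)) : Function.Surjective (hm a n g) := by
  obtain ⟨δ, h1, h2⟩ := les_d a n hf hg hfg
  intro c
  exact (h1 c).1 (Subsingleton.elim _ _)

lemma les_inj (h : Subsingleton (HH a n A)) : Function.Injective (hm a n g) := by
  rw [injective_iff_map_eq_zero]
  intro x hx
  obtain ⟨y, rfl⟩ := (les_b a n hf hg hfg x).1 hx
  rw [Subsingleton.elim y 0, map_zero]

lemma les_fsurj (h : Subsingleton (HH a n C)) : Function.Surjective (hm a n f) := fun y =>
  (les_b a n hf hg hfg y).1 (Subsingleton.elim _ _)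

lemma les_mid_sub (h : Subsingleton (HH a n A)) (h' : Subsingleton (HH a n C)) : Subsingleton (HH a n B) := by
  have := les_inj a n hf hg hfg h
  exact this.subsingleton

lemma les_shift (h : Subsingleton (HH a (n+1) B)) :
    ∃ δ : HH a n C →ₗ[R] HH a (n+1) A, Function.Surjective δ ∧ Function.Exact (hm a n g) δ := by
  obtain ⟨δ, h1, h2⟩ := les_d a n hf hg hfg
  exact ⟨δ, fun y => (h2 y).1 (Subsingleton.elim _ _), h1⟩
end

variable [IsNoetherianRing R]
lemma vanish_tors (a : Ideal R) (n : ℕ) : ∀ (M : Type u) [AddCommGroup M] [Module R M], gam a M = ⊤ → Subsingleton (HH a (n+1) M) := by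
  induction n with
  | zero =>
    intro M _ _ h
    obtain ⟨E, _, _, hE, f, hf, hE2⟩ := ex_inj_tors a h
    have hg := Submodule.mkQ_surjective (LinearMap.range f)
    have hfg := LinearMap.exact_map_mkQ_range f
    obtain ⟨δ, h1, h2⟩ := les_shift a 0 hf hg hfg (HH_inj a 0)
    have hs : Function.Surjective (hm a 0 (LinearMap.range f).mkQ) := by
      intro c
      obtain ⟨b, hb⟩ := hg (ev a _ c)
      have : b ∈ LinearMap.range (ev a E) := by rw [ev_range, hE2]; trivial
      obtain ⟨b', rfl⟩ := this
      refine ⟨b', ev_inj a _ ?_⟩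
      rw [ev_nat, hb]
    refine ⟨fun x y => ?_⟩
    obtain ⟨c, rfl⟩ := h1 x
    obtain ⟨c', rfl⟩ := h1 y
    rw [(h2 c).2 (hs c), (h2 c').2 (hs c')]
  | succ n ih =>
    intro M _ _ h
    obtain ⟨E, _, _, hE, f, hf, hE2⟩ := ex_inj_tors a h
    have hg := Submodule.mkQ_surjective (LinearMap.range f)
    have hfg := LinearMap.exact_map_mkQ_range f
    obtain ⟨δ, h1, h2⟩ := les_shift a (n+1) hf hg hfg (HH_inj a (n+1))
    have := ih _ (gam_top_of_surj a _ hg hE2)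
    exact h1.subsingleton

lemma gam_sup (a c : Ideal R) {M : Type u} [AddCommGroup M] [Module R M] (h : gam c M = ⊤) : gam a M = gam (a ⊔ c) M := by
  ext x
  constructor
  · rintro ⟨t, ht⟩
    obtain ⟨s, hs⟩ : x ∈ gam c M := h ▸ trivial
    refine ⟨t + s, fun r hr => ?_⟩
    obtain ⟨y, hy, z, hz, rfl⟩ := Submodule.mem_sup.1 (Ideal.sup_pow_add_le_pow_sup_pow hr)
    rw [add_smul, ht y hy, hs z hz, add_zero]
  · rintro ⟨t, ht⟩
    exact ⟨t, fun r hr => ht r (Ideal.pow_right_mono le_sup_left t hr)⟩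

lemma HH_sup (a c : Ideal R) (n : ℕ) : ∀ (M : Type u) [AddCommGroup M] [Module R M], gam c M = ⊤ →
    Nonempty (HH a (n+1) M ≃ₗ[R] HH (a ⊔ c) (n+1) M) := by
  induction n with
  | zero =>
    intro M _ _ h
    obtain ⟨E, _, _, hE, f, hf, hE2⟩ := ex_inj_tors c h
    have hg := Submodule.mkQ_surjective (LinearMap.range f)
    have hfg := LinearMap.exact_map_mkQ_range f
    obtain ⟨δ, h1, h2⟩ := les_shift a 0 hf hg hfg (HH_inj a 0)
    obtain ⟨δ', h1', h2'⟩ := les_shift (a ⊔ c) 0 hf hg hfg (HH_inj (a ⊔ c) 0)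
    have hC := gam_top_of_surj c _ hg hE2
    let e0 : HH a 0 (E ⧸ LinearMap.range f) ≃ₗ[R] HH (a ⊔ c) 0 (E ⧸ LinearMap.range f) :=
      (evE a _).trans ((LinearEquiv.ofEq _ _ (gam_sup a c hC)).trans (evE (a ⊔ c) _).symm)
    have he0 : ∀ x, ev (a ⊔ c) _ (e0 x) = ev a _ x := by
      intro x
      have : evE (a ⊔ c) _ (e0 x) = LinearEquiv.ofEq _ _ (gam_sup a c hC) (evE a _ x) := by
        simp [e0]
      exact congrArg Subtype.val this
    have hker : ∀ x, δ x = 0 ↔ δ' (e0 x) = 0 := by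
      intro x
      rw [h2 x, h2' (e0 x)]
      constructor
      · rintro ⟨b, rfl⟩
        have hb : ev a E b ∈ LinearMap.range (ev (a ⊔ c) E) := by
          rw [ev_range, ← gam_sup a c hE2, ← ev_range]; exact ⟨b, rfl⟩
        obtain ⟨b', hb'⟩ := hb
        refine ⟨b', ev_inj _ _ ?_⟩
        rw [he0, ev_nat, ev_nat, hb']
      · rintro ⟨b, hb0⟩
        have hb : ev (a ⊔ c) E b ∈ LinearMap.range (ev a E) := by
          rw [ev_range, gam_sup a c hE2, ← ev_range]; exact ⟨b, rfl⟩
        obtain ⟨b', hb'⟩ := hb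
        refine ⟨b', ev_inj _ _ ?_⟩
        rw [← he0 x, ← hb0, ev_nat, ev_nat, hb']
    have hk : LinearMap.ker δ = LinearMap.ker (δ' ∘ₗ e0.toLinearMap) := by
      ext x; exact hker x
    refine ⟨(δ.quotKerEquivOfSurjective h1).symm.trans ((Submodule.quotEquivOfEq _ _ hk).trans
      ((δ' ∘ₗ e0.toLinearMap).quotKerEquivOfSurjective (h1'.comp e0.surjective)))⟩
  | succ n ih =>
    intro M _ _ h
    obtain ⟨E, _, _, hE, f, hf, hE2⟩ := ex_inj_tors c h
    have hg := Submodule.mkQ_surjective (LinearMap.range f)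
    have hfg := LinearMap.exact_map_mkQ_range f
    have key : ∀ b : Ideal R, Nonempty (HH b (n+1) (E ⧸ LinearMap.range f) ≃ₗ[R] HH b (n+1+1) M) := by
      intro b
      obtain ⟨δ, h1, h2⟩ := les_shift b (n+1) hf hg hfg (HH_inj b (n+1))
      refine ⟨LinearEquiv.ofBijective δ ⟨?_, h1⟩⟩
      rw [injective_iff_map_eq_zero]
      intro x hx
      have := HH_inj b n (M := E)
      obtain ⟨y, rfl⟩ := (h2 x).1 hx
      rw [Subsingleton.elim y 0, map_zero]
    obtain ⟨e⟩ := ih _ (gam_top_of_surj c _ hg hE2)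
    obtain ⟨e1⟩ := key a
    obtain ⟨e2⟩ := key (a ⊔ c)
    exact ⟨e1.symm.trans (e.trans e2)⟩

lemma HH_rad {a b : Ideal R} (h : a.radical = b.radical) (n : ℕ) (M : Type u) [AddCommGroup M] [Module R M] :
    Nonempty (HH a n M ≃ₗ[R] HH b n M) :=
  ⟨((localCohomology.isoOfSameRadical h n).app (ModuleCat.of R M)).toLinearEquiv⟩

lemma gam_ann (c : Ideal R) {M : Type u} [AddCommGroup M] [Module R M] (h : c ≤ Module.annihilator R M) : gam c M = ⊤ := by
  rw [eq_top_iff]; rintro x -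
  exact ⟨1, fun r hr => Module.mem_annihilator.1 (h (by simpa using hr)) x⟩

lemma HH_rad_sup {a b c : Ideal R} {n : ℕ} (hn : 1 ≤ n) {M : Type u} [AddCommGroup M] [Module R M] (hc : c ≤ Module.annihilator R M)
    (h : (a ⊔ c).radical = b.radical) :
    Nonempty (HH a n M ≃ₗ[R] HH b n M) := by
  obtain ⟨n, rfl⟩ := Nat.exists_eq_add_of_le' hn
  obtain ⟨e⟩ := HH_sup a c n M (gam_ann c hc)
  obtain ⟨e'⟩ := HH_rad h (n+1) M
  exact ⟨e.trans e'⟩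

lemma HH_mod_gam (a : Ideal R) (n : ℕ) (M : Type u) [AddCommGroup M] [Module R M] :
    Nonempty (HH a (n+1) M ≃ₗ[R] HH a (n+1) (M ⧸ gam a M)) := by
  have h := vanish_tors a (M := gam a M)
  have hf := Submodule.injective_subtype (gam a M)
  have hg := Submodule.mkQ_surjective (gam a M)
  have hfg := LinearMap.exact_subtype_mkQ (gam a M)
  exact ⟨LinearEquiv.ofBijective _ ⟨les_inj a (n+1) hf hg hfg (h n (gam_gam a)), les_surj a (n+1) hf hg hfg (h (n+1) (gam_gam a))⟩⟩
end LC
end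

section
namespace LC
variable {R : Type u} [CommRing R]
open Pointwise

/-- dimension less than `n` -/
def dlt (R : Type u) [CommRing R] (N : Type u) [AddCommGroup N] [Module R N] (n : ℕ) : Prop :=
  Module.supportDim R N < (n : WithBot ℕ∞)

section
variable {M N : Type u} [AddCommGroup M] [Module R M] [AddCommGroup N] [Module R N]

lemma dlt_inj {n : ℕ} (f : M →ₗ[R] N) (hf : Function.Injective f) (h : dlt R N n) : dlt R M n :=
  (Module.supportDim_le_of_injective f hf).trans_lt h
lemma dlt_surj {n : ℕ} (f : M →ₗ[R] N) (hf : Function.Surjective f) (h : dlt R M n) : dlt R N n :=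
  (Module.supportDim_le_of_surjective f hf).trans_lt h
lemma dlt_mono {n k : ℕ} (hk : n ≤ k) (h : dlt R M n) : dlt R M k :=
  lt_of_lt_of_le h (by exact_mod_cast hk)
lemma dlt_sub {n : ℕ} [Subsingleton M] : dlt R M n := by
  unfold dlt; rw [Module.supportDim_eq_bot_of_subsingleton]; exact WithBot.bot_lt_coe _
lemma dlt_zero (h : dlt R M 0) : Subsingleton M := by
  rw [← Module.supportDim_eq_bot_iff_subsingleton R]
  unfold dlt at h
  by_contra h2
  obtain ⟨b, hb⟩ := WithBot.ne_bot_iff_exists.mp h2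
  rw [← hb] at h
  exact absurd h (by simp)
lemma dlt_of_succ {n : ℕ} {d : WithBot ℕ∞} (h : d + 1 < ((n+1 : ℕ) : WithBot ℕ∞)) : d < (n : WithBot ℕ∞) := by
  by_contra h2
  rw [not_lt] at h2
  have : ((n+1 : ℕ) : WithBot ℕ∞) ≤ d + 1 := by
    push_cast
    gcongr
  exact absurd h this.not_gt

lemma dlt_min [Module.Finite R M] {n : ℕ} {x : R} (hx : ∀ p ∈ (Module.annihilator R M).minimalPrimes, x ∉ p)
    (h : dlt R M (n+1)) : dlt R (QuotSMulTop x M) n :=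
  dlt_of_succ ((Module.supportDim_quotSMulTop_succ_le_of_notMem_minimalPrimes hx).trans_lt h)

lemma dlt_reg [Module.Finite R M] {n : ℕ} {x : R} (hx : IsSMulRegular M x)
    (h : dlt R M (n+1)) : dlt R (QuotSMulTop x M) n :=
  dlt_min (fun _ ↦ hx.notMem_of_mem_minimalPrimes) h

lemma qst_exact (x : R) : Function.Exact (LinearMap.lsmul R M x) (Submodule.mkQ (x • (⊤ : Submodule R M))) := by
  intro y
  simp [Submodule.mem_smul_pointwise_iff_exists]

lemma lsmul_inj {x : R} (hx : IsSMulRegular M x) : Function.Injective (LinearMap.lsmul R M x) := hx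

lemma hm_lsmul (a : Ideal R) (n : ℕ) (x : R) (y : HH a n M) : hm a n (LinearMap.lsmul R M x) y = x • y := by
  have h : LinearMap.lsmul R M x = x • LinearMap.id := rfl
  rw [h, hm_smul, hm_id]; rfl

variable [IsNoetherianRing R]

lemma gam_quot (a : Ideal R) [Module.Finite R M] : gam a (M ⧸ gam a M) = ⊥ := by
  rw [eq_bot_iff]
  intro y hy
  obtain ⟨y, rfl⟩ := Submodule.mkQ_surjective _ y
  obtain ⟨t, ht⟩ := hy
  obtain ⟨s, hs⟩ := fin_tors a (gam_gam (M := M) a)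
  rw [Submodule.mem_bot, Submodule.mkQ_apply, Submodule.Quotient.mk_eq_zero]
  refine ⟨s + t, fun r hr => ?_⟩
  rw [pow_add] at hr
  refine Submodule.mul_induction_on hr (fun p hp q hq => ?_) (fun p q h1 h2 => by rw [add_smul, h1, h2, add_zero])
  have := ht q hq
  rw [← map_smul, Submodule.mkQ_apply, Submodule.Quotient.mk_eq_zero] at this
  have := hs p hp ⟨_, this⟩
  rw [mul_smul]
  exact congrArg Subtype.val this

lemma avoid (a : Ideal R) {S : Set (Ideal R)} (hS : S.Finite) (hp : ∀ p ∈ S, p.IsPrime) (h : ∀ p ∈ S, ¬ a ≤ p) :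
    ∃ x ∈ a, ∀ p ∈ S, x ∉ p := by
  by_contra! h2
  have : (a : Set R) ⊆ ⋃ p ∈ S, (p : Set R) := fun x hx => by
    obtain ⟨p, hp, hx⟩ := h2 x hx
    simp only [Set.mem_iUnion]; exact ⟨p, hp, hx⟩
  have h3 := (Ideal.subset_union_prime_finite (f := id) hS ⊥ ⊥ (fun p hp' _ _ => hp p hp')).mp this
  obtain ⟨p, hp, hx⟩ := h3
  exact h p hp hx

lemma ass_gam (a : Ideal R) (h : gam a M = ⊥) {p : Ideal R} (hp : p ∈ associatedPrimes R M) : ¬ a ≤ p := by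
  intro hle
  obtain ⟨h1, x, hx⟩ := (isAssociatedPrime_iff (R := R)).mp hp
  have hxg : x ∈ gam a M := ⟨1, fun r hr => by
    rw [pow_one] at hr
    have := hle hr
    rw [hx] at this
    simpa [Submodule.mem_colon_singleton] using this⟩
  rw [h, Submodule.mem_bot] at hxg
  subst hxg
  apply h1.ne_top
  rw [hx]; ext; simp [Submodule.mem_colon_singleton]

lemma reg_of_notMem {x : R} (h : ∀ p ∈ associatedPrimes R M, x ∉ p) : IsSMulRegular M x := by
  have := biUnion_associatedPrimes_eq_compl_regular R M
  by_contra h2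
  have h3 : x ∈ {r : R | IsSMulRegular M r}ᶜ := h2
  rw [← this] at h3
  simp only [Set.mem_iUnion] at h3
  obtain ⟨p, hp, hx⟩ := h3
  exact h p hp hx

lemma reg_of_gam (a : Ideal R) [Module.Finite R M] (h : gam a M = ⊥) : ∃ x ∈ a, IsSMulRegular M x := by
  obtain ⟨x, hx, h2⟩ := avoid a (associatedPrimes.finite R M) (fun p hp => hp.isPrime) (fun p hp => ass_gam a h hp)
  exact ⟨x, hx, reg_of_notMem h2⟩

/-- Grothendieck vanishing -/
theorem van (a : Ideal R) (n : ℕ) : ∀ (N : Type u) [AddCommGroup N] [Module R N] [Module.Finite R N], dlt R N n →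
    Subsingleton (HH a n N) := by
  induction n with
  | zero =>
    intro N _ _ _ h
    have := dlt_zero h
    exact HH_sub a 0
  | succ n ih =>
    intro N _ _ _ h
    obtain ⟨e⟩ := HH_mod_gam a n N
    refine e.toEquiv.subsingleton_congr.mpr ?_
    obtain ⟨x, hxa, hx⟩ := reg_of_gam a (gam_quot (M := N) a)
    have h1 := dlt_reg hx (dlt_surj _ (Submodule.mkQ_surjective (gam a N)) h)
    have h2 := ih _ h1
    obtain ⟨δ, h3, h4⟩ := les_d a n (lsmul_inj hx) (Submodule.mkQ_surjective _) (qst_exact x)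
    have h5 : ∀ y : HH a (n+1) (N ⧸ gam a N), x • y = 0 → y = 0 := by
      intro y hy
      have := hm_lsmul a (n+1) x y
      rw [hy] at this
      obtain ⟨z, rfl⟩ := (h4 y).mp this
      rw [h2.elim z 0, map_zero]
    refine ⟨fun y z => ?_⟩
    have h6 : ∀ t (y : HH a (n+1) (N ⧸ gam a N)), x^t • y = 0 → y = 0 := by
      intro t
      induction t with
      | zero => intro y hy; simpa using hy
      | succ t iht => intro y hy; rw [pow_succ, mul_smul] at hy; exact h5 _ (iht _ hy)
    have h7 : ∀ y : HH a (n+1) (N ⧸ gam a N), y = 0 := fun y => by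
      obtain ⟨t, ht⟩ := HH_tors a (n+1) y
      exact h6 t y (ht _ (Ideal.pow_mem_pow hxa t))
    rw [h7 y, h7 z]
end
end LC
end

section
namespace LC
variable {R : Type u} [CommRing R]

section hull
variable [IsLocalRing R] {I : Type u} [AddCommGroup I] [Module R I]
open IsLocalRing

/-- every nonzero element of `E` generates `v` -/
def ess (v : I) (E : Submodule R I) : Prop := ∀ y ∈ E, y ≠ 0 → v ∈ Submodule.span R {y}

lemma ex_ess (v : I) (hv : ∀ r ∈ maximalIdeal R, r • v = 0) :
    ∃ E : Submodule R I, v ∈ E ∧ ess v E ∧ ∀ E' : Submodule R I, E ≤ E' → ess v E' → E' = E := by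
  obtain ⟨E, h1, h2⟩ := zorn_le_nonempty₀ {E : Submodule R I | ess v E} (fun c hc hch y hy => by
    refine ⟨sSup c, ?_, fun z hz => le_sSup hz⟩
    intro z hz hz0
    obtain ⟨w, hw, hzw⟩ := (Submodule.mem_sSup_of_directed ⟨y, hy⟩ hch.directedOn).mp hz
    exact hc hw z hzw hz0) (Submodule.span R {v}) (by
      intro y hy hy0
      obtain ⟨r, rfl⟩ := Submodule.mem_span_singleton.mp hy
      have : IsUnit r := by
        by_contra h
        exact hy0 (hv r h)
      obtain ⟨u, rfl⟩ := this
      refine Submodule.mem_span_singleton.mpr ⟨(u⁻¹ : Rˣ), ?_⟩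
      rw [smul_smul]; simp)
  exact ⟨E, h1 (Submodule.mem_span_singleton_self v), h2.1, fun E' h3 h4 => (h2.eq_of_le h4 h3).symm⟩

lemma ex_compl (v : I) (hv : v ≠ 0) : ∃ C : Submodule R I, v ∉ C ∧ ∀ C' : Submodule R I, C ≤ C' → v ∉ C' → C' = C := by
  obtain ⟨E, h1, h2⟩ := zorn_le_nonempty₀ {E : Submodule R I | v ∉ E} (fun c hc hch y hy => by
    refine ⟨sSup c, ?_, fun z hz => le_sSup hz⟩
    intro hz
    obtain ⟨w, hw, hzw⟩ := (Submodule.mem_sSup_of_directed ⟨y, hy⟩ hch.directedOn).mp hz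
    exact hc hw hzw) ⊥ (by simpa using hv)
  exact ⟨E, h2.1, fun E' h3 h4 => (h2.eq_of_le h4 h3).symm⟩

lemma ess_inj [hI : Module.Injective R I] (v : I) (hv0 : v ≠ 0) {E : Submodule R I}
    (hE : v ∈ E) (he : ess v E) (hmax : ∀ E' : Submodule R I, E ≤ E' → ess v E' → E' = E) : Module.Injective R E := by
  obtain ⟨C, hC, hC2⟩ := ex_compl (R := R) v hv0
  have hes : ∀ z : I ⧸ C, z ≠ 0 → C.mkQ v ∈ Submodule.span R {z} := by
    intro z hz
    obtain ⟨y, rfl⟩ := C.mkQ_surjective z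
    have hv : v ∈ C ⊔ Submodule.span R {y} := by
      by_contra h
      have := hC2 _ le_sup_left h
      have hy : y ∈ C := by rw [← this]; exact Submodule.mem_sup_right (Submodule.mem_span_singleton_self y)
      exact hz (by simpa using hy)
    obtain ⟨c, hc, d, hd, rfl⟩ := Submodule.mem_sup.mp hv
    obtain ⟨r, rfl⟩ := Submodule.mem_span_singleton.mp hd
    refine Submodule.mem_span_singleton.mpr ⟨r, ?_⟩
    have : C.mkQ c = 0 := by simpa using hc
    rw [map_add, this, zero_add, map_smul]
  have hinj : Function.Injective (C.mkQ ∘ₗ E.subtype) := by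
    rw [injective_iff_map_eq_zero]
    rintro ⟨y, hy⟩ h
    by_contra h0
    have h0' : y ≠ 0 := fun h => h0 (Subtype.ext h)
    have hyC : y ∈ C := by simpa using h
    exact hC ((Submodule.span_singleton_le_iff_mem y C).mpr hyC (he y hy h0'))
  obtain ⟨φ, hφ⟩ := hI.out (C.mkQ ∘ₗ E.subtype) hinj E.subtype
  have hr : LinearMap.range φ = E := by
    apply hmax
    · intro e he; exact ⟨_, hφ ⟨e, he⟩⟩
    · rintro y ⟨z, rfl⟩ hy
      have hz : z ≠ 0 := by rintro rfl; simp at hy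
      obtain ⟨r, hr⟩ := Submodule.mem_span_singleton.mp (hes z hz)
      refine Submodule.mem_span_singleton.mpr ⟨r, ?_⟩
      rw [← map_smul, hr]
      exact hφ ⟨v, hE⟩
  let π : I →ₗ[R] E := LinearMap.codRestrict E (φ ∘ₗ C.mkQ) (fun c => by
    exact hr.le ⟨C.mkQ c, rfl⟩)
  have hπ : ∀ e : E, π e = e := fun e => Subtype.ext (hφ e)
  constructor
  intro X Y _ _ _ _ f hf g
  obtain ⟨h, hh⟩ := hI.out f hf (E.subtype ∘ₗ g)
  refine ⟨π ∘ₗ h, fun x => ?_⟩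
  rw [LinearMap.comp_apply, hh]
  exact hπ _

variable (R) in
/-- an injective hull of the residue field -/
structure Hull where
  E : Type u
  [i1 : AddCommGroup E]
  [i2 : Module R E]
  [inj : Module.Injective R E]
  v : E
  v0 : v ≠ 0
  vm : ∀ r ∈ maximalIdeal R, r • v = 0
  soc : ∀ y : E, (∀ r ∈ maximalIdeal R, r • y = 0) → y ∈ Submodule.span R {v}

attribute [instance] Hull.i1 Hull.i2 Hull.inj

variable (R) in
lemma ex_hull : Nonempty (Hull R) := by
  obtain ⟨I, _, _, _, f, hf⟩ := ex_inj (R := R) (M := R ⧸ maximalIdeal R)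
  let v := f 1
  have hv0 : v ≠ 0 := by
    intro h
    have : (1 : R ⧸ maximalIdeal R) = 0 := hf (h.trans (map_zero f).symm)
    have h1 : (1 : R) ∈ maximalIdeal R := by
      rwa [← Ideal.Quotient.eq_zero_iff_mem, map_one]
    exact (Ideal.ne_top_iff_one _).mp (maximalIdeal.isMaximal R).ne_top h1
  have hvm : ∀ r ∈ maximalIdeal R, r • v = 0 := by
    intro r hr
    rw [← map_smul]
    have : r • (1 : R ⧸ maximalIdeal R) = 0 := by
      rw [Algebra.smul_def, mul_one]; exact Ideal.Quotient.eq_zero_iff_mem.mpr hr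
    rw [this, map_zero]
  obtain ⟨E, h1, h2, h3⟩ := ex_ess v hvm
  have := ess_inj v hv0 h1 h2 h3
  refine ⟨{ E := E, v := ⟨v, h1⟩, v0 := fun h => hv0 (congrArg Subtype.val h), vm := fun r hr => Subtype.ext (hvm r hr), soc := ?_}⟩
  rintro ⟨y, hy⟩ hm
  by_cases hy0 : y = 0
  · subst hy0; exact Submodule.zero_mem _
  obtain ⟨r, hr⟩ := Submodule.mem_span_singleton.mp (h2 y hy hy0)
  have hu : IsUnit r := by
    by_contra h
    apply hv0
    rw [← hr]
    exact congrArg Subtype.val (hm r h)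
  obtain ⟨u, rfl⟩ := hu
  refine Submodule.mem_span_singleton.mpr ⟨(u⁻¹ : Rˣ), Subtype.ext ?_⟩
  change ((u⁻¹ : Rˣ) : R) • v = y
  rw [← hr, smul_smul]; simp

variable (R) in
/-- chosen hull -/
def hull : Hull R := Classical.choice (ex_hull R)
variable (R) in
/-- injective hull of residue field -/
abbrev EE : Type u := (hull R).E

/-- Matlis dual -/
abbrev DD (N : Type u) [AddCommGroup N] [Module R N] : Type u := N →ₗ[R] EE R

end hull

section dual
open IsLocalRing
variable [IsLocalRing R] {A B C : Type u} [AddCommGroup A] [Module R A] [AddCommGroup B] [Module R B] [AddCommGroup C] [Module R C]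
variable (f : A →ₗ[R] B) (g : B →ₗ[R] C)

/-- dual map -/
def dm : DD (R := R) B →ₗ[R] DD (R := R) A := LinearMap.lcomp R (EE R) f

lemma dm_apply (h : DD (R := R) B) : dm f h = h ∘ₗ f := rfl

variable {f g}
lemma dm_inj (hf : Function.Surjective f) : Function.Injective (dm f) := by
  intro x y h
  ext b
  obtain ⟨a, rfl⟩ := hf b
  exact LinearMap.congr_fun h a

lemma dm_surj (hf : Function.Injective f) : Function.Surjective (dm f) := by
  intro h
  obtain ⟨k, hk⟩ := (hull R).inj.out f hf h
  exact ⟨k, LinearMap.ext hk⟩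

lemma dm_exact (hfg : Function.Exact f g) : Function.Exact (dm g) (dm f) := by
  intro h
  constructor
  · intro h0
    have hle : LinearMap.ker g ≤ LinearMap.ker h := by
        intro b hb
        obtain ⟨a, rfl⟩ := (hfg b).mp hb
        exact LinearMap.congr_fun h0 a
    let k : LinearMap.range g →ₗ[R] EE R := (LinearMap.ker g).liftQ h hle ∘ₗ g.quotKerEquivRange.symm.toLinearMap
    obtain ⟨l, hl⟩ := (hull R).inj.out (LinearMap.range g).subtype (Submodule.injective_subtype _) k
    refine ⟨l, LinearMap.ext fun b => ?_⟩
    have := hl ⟨g b, b, rfl⟩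
    refine this.trans ?_
    have h2 : g.quotKerEquivRange.symm ⟨g b, b, rfl⟩ = Submodule.Quotient.mk b := by
      rw [LinearEquiv.symm_apply_eq]; rfl
    change (LinearMap.ker g).liftQ h hle (g.quotKerEquivRange.symm ⟨g b, b, rfl⟩) = h b
    rw [h2]; rfl
  · rintro ⟨k, rfl⟩
    ext a
    have : g (f a) = 0 := (hfg _).mpr ⟨a, rfl⟩
    simp [dm_apply, this]

lemma DD_faith (h : gam (maximalIdeal R) A = ⊤) (hD : Subsingleton (DD (R := R) A)) : Subsingleton A := by
  by_contra hne
  rw [not_subsingleton_iff_nontrivial] at hne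
  -- find a socle element
  obtain ⟨x, hx⟩ := exists_ne (0 : A)
  have hx2 : x ∈ gam (maximalIdeal R) A := h ▸ trivial
  have key : ∀ t (x : A), x ≠ 0 → (∀ r ∈ maximalIdeal R ^ t, r • x = 0) → ∃ y : A, y ≠ 0 ∧ ∀ r ∈ maximalIdeal R, r • y = 0 := by
    intro t
    induction t with
    | zero => intro x hx h; exact absurd (by simpa using h 1 (by simp)) hx
    | succ t ih =>
      intro x hx h
      by_cases h2 : ∀ r ∈ maximalIdeal R, r • x = 0
      · exact ⟨x, hx, h2⟩
      push Not at h2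
      obtain ⟨r, hr, h3⟩ := h2
      refine ih _ h3 fun s hs => ?_
      rw [smul_smul]
      exact h _ (by rw [pow_succ]; exact Ideal.mul_mem_mul hs hr)
  obtain ⟨t, ht⟩ := hx2
  obtain ⟨y, hy, hym⟩ := key t x hx ht
  have hk : (LinearMap.toSpanSingleton R A y).ker = maximalIdeal R := by
    refine ((maximalIdeal.isMaximal R).eq_of_le ?_ ?_).symm
    · intro h
      have : (1 : R) ∈ (LinearMap.toSpanSingleton R A y).ker := by rw [h]; trivial
      simp at this; exact hy this
    · intro r hr; simpa using hym r hr
  let φ : (R ⧸ maximalIdeal R) →ₗ[R] A := (maximalIdeal R).liftQ (LinearMap.toSpanSingleton R A y) hk.ge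
  have hφ : Function.Injective φ := by
    rw [← LinearMap.ker_eq_bot]
    exact Submodule.ker_liftQ_eq_bot _ _ _ hk.le
  obtain ⟨ψ, hψ⟩ := dm_surj hφ ((maximalIdeal R).liftQ (LinearMap.toSpanSingleton R (EE R) (hull R).v) (by
    intro r hr; simpa using (hull R).vm r hr))
  apply (hull R).v0
  have := LinearMap.congr_fun hψ (Submodule.Quotient.mk 1)
  rw [hD.elim ψ 0] at this
  have h3 : (dm φ 0) (Submodule.Quotient.mk 1) = 0 := rfl
  rw [h3, Submodule.liftQ_apply] at this
  simpa using this.symm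

lemma DD_sub : Subsingleton A → Subsingleton (DD (R := R) A) := fun h => ⟨fun x y => by
  ext a; rw [h.elim a 0]; simp⟩

/-- torsion submodules of E -/
def ET (t : ℕ) : Submodule R (EE R) where
  carrier := {y | ∀ r ∈ maximalIdeal R ^ t, r • y = 0}
  add_mem' := fun h1 h2 r hr => by rw [smul_add, h1 r hr, h2 r hr, add_zero]
  zero_mem' := by simp
  smul_mem' := fun c y h r hr => by rw [smul_comm, h r hr, smul_zero]

variable [IsNoetherianRing R]

lemma ET_fin (t : ℕ) : (ET (R := R) t).FG := by
  induction t with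
  | zero =>
    have : ET (R := R) 0 = ⊥ := by
      rw [eq_bot_iff]; intro y hy; simpa using hy 1 (by simp)
    rw [this]; exact Submodule.fg_bot
  | succ t ih =>
    obtain ⟨S, hS⟩ := (isNoetherianRing_iff_ideal_fg R).mp inferInstance (maximalIdeal R)
    let F : EE R →ₗ[R] (S → EE R) := LinearMap.pi fun s => LinearMap.lsmul R (EE R) s
    have hSm : ∀ s ∈ S, s ∈ maximalIdeal R := fun s hs => by
      rw [← hS]; exact Submodule.subset_span hs
    have : Module.Finite R (ET (R := R) t) := Module.Finite.iff_fg.mpr ih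
    let P : Submodule R (S → EE R) := Submodule.pi Set.univ (fun _ => ET t)
    have hP : IsNoetherian R P := by
      let G : P →ₗ[R] (S → ET (R := R) t) := LinearMap.pi fun s => LinearMap.codRestrict _ (LinearMap.proj s ∘ₗ P.subtype) (fun p => p.2 s trivial)
      refine isNoetherian_of_injective G ?_
      intro p q h
      ext s
      exact congrArg Subtype.val (congrFun h s)
    apply Submodule.fg_of_fg_map_of_fg_inf_ker F
    · have hle : (ET (R := R) (t+1)).map F ≤ P := by
        rintro _ ⟨y, hy, rfl⟩ s -
        intro r hr
        change r • ((s : R) • y) = 0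
        rw [smul_smul]
        exact hy _ (by rw [pow_succ]; exact Ideal.mul_mem_mul hr (hSm _ s.2))
      exact isNoetherian_submodule.mp hP _ hle
    · have hle : ET (R := R) (t+1) ⊓ LinearMap.ker F ≤ Submodule.span R {(hull R).v} := by
        rintro y ⟨-, hy⟩
        apply (hull R).soc
        intro r hr
        rw [← hS] at hr
        refine Submodule.span_induction (p := fun r _ => r • y = 0) ?_ (by simp) ?_ ?_ hr
        · intro s hs; exact congrFun hy ⟨s, hs⟩
        · intro a b _ _ h1 h2; rw [add_smul, h1, h2, add_zero]
        · intro a b _ h1; rw [smul_assoc, h1, smul_zero]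
      have : IsNoetherian R (Submodule.span R {(hull R).v}) :=
        isNoetherian_of_isNoetherianRing_of_finite R _
      exact isNoetherian_submodule.mp this _ hle

lemma DD_fin [Module.Finite R A] (h : gam (maximalIdeal R) A = ⊤) : Module.Finite R (DD (R := R) A) := by
  obtain ⟨t, ht⟩ := fin_tors _ h
  obtain ⟨S, hS⟩ := (Module.Finite.fg_top : (⊤ : Submodule R A).FG)
  have : Module.Finite R (ET (R := R) t) := Module.Finite.iff_fg.mpr (ET_fin t)
  let G : DD (R := R) A →ₗ[R] (S → ET (R := R) t) := LinearMap.pi fun s =>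
    LinearMap.codRestrict _ (LinearMap.applyₗ (s : A)) (fun p r hr => by
      change r • p s = 0
      rw [← map_smul, ht r hr, map_zero])
  refine Module.Finite.of_injective G ?_
  intro p q h
  refine LinearMap.ext_on (s := (S : Set A)) hS ?_
  intro s hs
  exact congrArg Subtype.val (congrFun h ⟨s, hs⟩)

end dual
end LC
end

section
set_option linter.unusedSectionVars false
namespace LC
variable {R : Type u} [CommRing R]
open IsLocalRing

lemma prec_pi (I : Ideal R) [IsPrecomplete I R] (n : ℕ) : IsPrecomplete I (Fin n → R) := by
  have hmem : ∀ (k : ℕ) (x : Fin n → R), x ∈ (I ^ k • ⊤ : Submodule R (Fin n → R)) ↔ ∀ i, x i ∈ (I ^ k • ⊤ : Submodule R R) := by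
    intro k x
    constructor
    · intro hx i
      have : x i ∈ Submodule.map (LinearMap.proj i) (I ^ k • ⊤ : Submodule R (Fin n → R)) := ⟨x, hx, rfl⟩
      rw [Submodule.map_smul''] at this
      exact Submodule.smul_mono le_rfl le_top this
    · intro h
      rw [pi_eq_sum_univ x]
      refine Submodule.sum_mem _ fun i _ => Submodule.smul_mem_smul (by simpa using h i) trivial
  constructor
  intro f hf
  have : ∀ i, ∃ L : R, ∀ k, f k i ≡ L [SMOD (I ^ k • ⊤ : Submodule R R)] := by
    intro i
    apply IsPrecomplete.prec' 
    intro m k hmk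
    have := hf hmk
    rw [SModEq.sub_mem] at this ⊢
    exact (hmem _ _).mp this i
  choose L hL using this
  refine ⟨L, fun k => ?_⟩
  rw [SModEq.sub_mem, hmem]
  intro i
  have := hL i k
  rwa [SModEq.sub_mem] at this

lemma complete_fg [IsNoetherianRing R] (I : Ideal R) [IsPrecomplete I R] {N P : Type u} [AddCommGroup N] [Module R N] [AddCommGroup P] [Module R P]
    [IsHausdorff I N] [Module.Finite R P] (f : N →ₗ[R] P) (hf : LinearMap.ker f ≤ I • ⊤) : Module.Finite R N := by
  have h1 : Module.Finite R (N ⧸ LinearMap.ker f) :=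
    Module.Finite.of_injective (f.quotKerEquivRange.toLinearMap) f.quotKerEquivRange.injective
  have h2 : Module.Finite R (N ⧸ (I • ⊤ : Submodule R N)) :=
    Module.Finite.of_surjective (Submodule.factor hf) (Submodule.factor_surjective hf)
  obtain ⟨n, g, hg⟩ := Module.Finite.exists_fin' R (N ⧸ (I • ⊤ : Submodule R N))
  obtain ⟨h, hh⟩ := Module.projective_lifting_property (Submodule.mkQ (I • ⊤ : Submodule R N)) g (Submodule.mkQ_surjective _)
  have := prec_pi I n
  exact Module.Finite.of_surjective h (surjective_of_mkQ_comp_surjective (I := I) (by rw [hh]; exact hg))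

section
variable [IsNoetherianRing R] {M : Type u} [AddCommGroup M] [Module R M]

lemma gam_of_pow (a : Ideal R) (s : ℕ) (y : M) (h : ∀ p ∈ a ^ s, p • y ∈ gam a M) : y ∈ gam a M := by
  let K : Submodule R M := Submodule.map (LinearMap.toSpanSingleton R M y) (a ^ s)
  have hK : Module.Finite R K := Module.Finite.iff_fg.mpr (Submodule.FG.map _ ((isNoetherianRing_iff_ideal_fg R).mp inferInstance (a ^ s)))
  have hg : gam a K = ⊤ := by
    rw [eq_top_iff]
    rintro ⟨_, p, hp, rfl⟩ -
    obtain ⟨t, ht⟩ := h p hp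
    exact ⟨t, fun r hr => Subtype.ext (ht r hr)⟩
  obtain ⟨t, ht⟩ := fin_tors a hg
  refine ⟨t + s, fun r hr => ?_⟩
  rw [pow_add] at hr
  refine Submodule.mul_induction_on hr (fun p hp q hq => ?_) (fun p q h1 h2 => by rw [add_smul, h1, h2, add_zero])
  rw [mul_smul]
  exact congrArg Subtype.val (ht p hp ⟨q • y, q, hq, rfl⟩)

variable [IsLocalRing R]

lemma gam_zero [Module.Finite R M] (h : dlt R M 1) : gam (maximalIdeal R) M = ⊤ := by
  obtain ⟨x, hxm, hx⟩ := reg_of_gam _ (gam_quot (M := M) (maximalIdeal R))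
  have h1 := dlt_zero (dlt_reg hx (dlt_surj _ (Submodule.mkQ_surjective (gam (maximalIdeal R) M)) h))
  have h2 : Subsingleton (M ⧸ gam (maximalIdeal R) M) := by
    by_contra hne
    rw [not_subsingleton_iff_nontrivial] at hne
    have h3 := (Submodule.Quotient.subsingleton_iff).mp h1
    refine (Submodule.top_ne_pointwise_smul_of_mem_jacobson_annihilator (R := R) (M := M ⧸ gam (maximalIdeal R) M) (r := x) ?_).symm h3
    exact (maximalIdeal_le_jacobson _) hxm
  exact (Submodule.Quotient.subsingleton_iff).mp h2

lemma haus_dual (h : gam (maximalIdeal R) M = ⊤) : IsHausdorff (maximalIdeal R) (DD (R := R) M) := by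
  constructor
  intro f hf
  ext y
  obtain ⟨t, ht⟩ : y ∈ gam (maximalIdeal R) M := h ▸ trivial
  have := hf t
  rw [SModEq.zero] at this
  refine Submodule.smul_induction_on (p := fun f => f y = (0 : DD (R := R) M) y) this ?_ ?_
  · intro r hr g _
    rw [LinearMap.smul_apply, ← map_smul, ht r hr, map_zero, LinearMap.zero_apply]
  · intro f g h1 h2
    rw [LinearMap.add_apply, h1, h2]; simp

lemma HH_top (i : ℕ) : Subsingleton (HH (⊤ : Ideal R) i M) := by
  have : ∀ x : HH (⊤ : Ideal R) i M, x = 0 := fun x => by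
    obtain ⟨t, ht⟩ := HH_tors _ i x
    rw [← one_smul R x]; exact ht 1 (by rw [Ideal.top_pow]; trivial)
  exact ⟨fun x y => (this x).trans (this y).symm⟩

lemma gam_sub [Subsingleton M] (a : Ideal R) : gam a M = ⊤ := Subsingleton.elim _ _

lemma DD_sub_fin [Subsingleton M] : Module.Finite R (DD (R := R) M) :=
  have := DD_sub (R := R) (A := M) inferInstance
  inferInstance

lemma dm_lsmul (r : R) (h : DD (R := R) M) : dm (LinearMap.lsmul R M r) h = r • h := by
  ext y
  exact map_smul h r y

theorem finiteness [IsAdicComplete (maximalIdeal R) R] (a : Ideal R) (i : ℕ) : ∀ (M : Type u) [AddCommGroup M] [Module R M] [Module.Finite R M],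
    (a = maximalIdeal R ∨ dlt R M (i+1)) → gam (maximalIdeal R) (HH a i M) = ⊤ ∧ Module.Finite R (DD (R := R) (HH a i M)) := by
  by_cases hat : a = ⊤
  · subst hat
    intro M _ _ _ _
    have := HH_top (R := R) (M := M) i
    exact ⟨gam_sub _, DD_sub_fin⟩
  have ham : a ≤ maximalIdeal R := le_maximalIdeal hat
  induction i with
  | zero =>
    intro M _ _ _ h
    have h1 : gam (maximalIdeal R) (HH a 0 M) = ⊤ := by
      rcases h with rfl | h
      · exact gam_top_of_inj _ (evE _ M).toLinearMap (evE _ M).injective (gam_gam _)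
      · exact gam_top_of_inj _ (ev _ M) (ev_inj _ M) (gam_zero h)
    have : Module.Finite R (HH a 0 M) := Module.Finite.of_injective (ev a M) (ev_inj a M)
    exact ⟨h1, DD_fin h1⟩
  | succ i ih =>
    intro M _ _ _ h
    obtain ⟨e⟩ := HH_mod_gam a i M
    suffices hs : gam (maximalIdeal R) (HH a (i+1) (M ⧸ gam a M)) = ⊤ ∧ Module.Finite R (DD (R := R) (HH a (i+1) (M ⧸ gam a M))) by
      obtain ⟨h1, h2⟩ := hs
      exact ⟨gam_top_of_inj _ e.toLinearMap e.injective h1,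
        Module.Finite.of_surjective (dm e.toLinearMap) (dm_surj e.injective)⟩
    obtain ⟨r, hra, hr⟩ := reg_of_gam a (gam_quot (M := M) a)
    obtain ⟨h1, h2⟩ := ih (QuotSMulTop r (M ⧸ gam a M)) (by
      rcases h with rfl | h
      · exact Or.inl rfl
      · exact Or.inr (dlt_reg hr (dlt_surj _ (Submodule.mkQ_surjective (gam a M)) h)))
    obtain ⟨δ, h3, h4⟩ := les_d a i (lsmul_inj hr) (Submodule.mkQ_surjective _) (qst_exact r)
    have h4' : Function.Exact δ (LinearMap.lsmul R (HH a (i+1) (M ⧸ gam a M)) r) := by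
      have : hm a (i+1) (LinearMap.lsmul R (M ⧸ gam a M) r) = LinearMap.lsmul R (HH a (i+1) (M ⧸ gam a M)) r :=
        LinearMap.ext fun y => hm_lsmul a (i+1) r y
      rw [← this]; exact h4
    have hker : ∀ y : HH a (i+1) (M ⧸ gam a M), r • y = 0 → y ∈ gam (maximalIdeal R) _ := by
      intro y hy
      obtain ⟨z, rfl⟩ := (h4' y).mp hy
      exact gam_map _ δ (h1 ▸ trivial)
    have htor : gam (maximalIdeal R) (HH a (i+1) (M ⧸ gam a M)) = ⊤ := by
      have key : ∀ t (y : HH a (i+1) (M ⧸ gam a M)), r ^ t • y = 0 → y ∈ gam (maximalIdeal R) _ := by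
        intro t
        induction t with
        | zero => intro y hy; rw [pow_zero, one_smul] at hy; rw [hy]; exact Submodule.zero_mem _
        | succ t iht =>
          intro y hy
          rw [pow_succ, mul_smul] at hy
          obtain ⟨s, hs⟩ := iht _ hy
          refine gam_of_pow _ s y fun p hp => hker _ ?_
          rw [smul_comm]; exact hs p hp
      rw [eq_top_iff]; rintro y -
      obtain ⟨t, ht⟩ := HH_tors a (i+1) y
      exact key t y (ht _ (Ideal.pow_mem_pow hra t))
    refine ⟨htor, ?_⟩
    have := haus_dual htor
    refine complete_fg (maximalIdeal R) (dm δ) ?_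
    intro f hf
    obtain ⟨g, rfl⟩ := (dm_exact h4' f).mp hf
    rw [dm_lsmul]
    exact Submodule.smul_mem_smul (ham hra) trivial
end
end LC
end

section
set_option linter.unusedSectionVars false
namespace LC
variable {R : Type u} [CommRing R]
open IsLocalRing Pointwise

lemma not_dlt_iff {M : Type u} [AddCommGroup M] [Module R M] {n : ℕ} :
    ¬ dlt R M n ↔ ∃ l : LTSeries (Module.support R M), l.length = n := by
  unfold dlt Module.supportDim
  rw [not_lt]
  exact Order.le_krullDim_iff

lemma mem_supp_quot (p : Ideal R) (q : PrimeSpectrum R) : q ∈ Module.support R (R ⧸ p) ↔ p ≤ q.asIdeal := by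
  rw [Module.mem_support_iff_of_finite, Ideal.annihilator_quotient]

lemma dlt_iff {M : Type u} [AddCommGroup M] [Module R M] {n : ℕ} :
    dlt R M n ↔ ∀ p ∈ Module.support R M, dlt R (R ⧸ p.asIdeal) n := by
  constructor
  · intro h p hp
    by_contra h2
    obtain ⟨l, hl⟩ := not_dlt_iff.mp h2
    refine not_dlt_iff.mpr ⟨l.map (fun q => ⟨q.1, Module.mem_support_mono ((mem_supp_quot _ _).mp q.2) hp⟩) (fun _ _ h => h), hl⟩ h
  · intro h
    by_contra h2
    obtain ⟨l, hl⟩ := not_dlt_iff.mp h2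
    have hh : ∀ i, l.head.1.asIdeal ≤ (l i).1.asIdeal := fun i => by
      have := l.head_le i
      exact this
    refine not_dlt_iff.mpr ⟨{ length := l.length, toFun := fun i => ⟨(l i).1, (mem_supp_quot _ _).mpr (hh i)⟩, step := fun i => l.step i }, hl⟩ (h _ l.head.2)

section
variable [IsLocalRing R]

lemma dlt_field : dlt R (R ⧸ maximalIdeal R) 1 := by
  unfold dlt
  rw [Module.supportDim_quotient_eq_ringKrullDim]
  have : ringKrullDim (R ⧸ maximalIdeal R) = 0 :=
    ringKrullDim_eq_zero_of_isField ((Ideal.Quotient.maximal_ideal_iff_isField_quotient _).mp inferInstance)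
  rw [this]; norm_num

variable [IsNoetherianRing R]

lemma dlt_mod_gam {M : Type u} [AddCommGroup M] [Module R M] [Module.Finite R M] {n : ℕ}
   (h : dlt R (M ⧸ gam (maximalIdeal R) M) (n+1)) : dlt R M (n+1) := by
  rw [dlt_iff] at h ⊢
  intro p hp
  rw [Module.support_of_exact (LinearMap.exact_subtype_mkQ (gam (maximalIdeal R) M)) (Submodule.injective_subtype _) (Submodule.mkQ_surjective _)] at hp
  rcases hp with hp | hp
  · obtain ⟨t, ht⟩ := fin_tors _ (gam_gam (M := M) (maximalIdeal R))
    have h1 : maximalIdeal R ^ t ≤ Module.annihilator R (gam (maximalIdeal R) M) := fun r hr =>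
      Module.mem_annihilator.mpr (ht r hr)
    have h2 := h1.trans (Module.mem_support_iff_of_finite.mp hp)
    have h3 := p.2.le_of_pow_le h2
    have h4 : p.asIdeal = maximalIdeal R := le_antisymm (le_maximalIdeal p.2.ne_top) h3
    rw [h4]
    exact dlt_mono (by omega) dlt_field
  · exact h p hp

lemma succ_lt {d : WithBot ℕ∞} {n : ℕ} (h : d < (n : WithBot ℕ∞)) : d + 1 < ((n + 1 : ℕ) : WithBot ℕ∞) := by
  induction d with
  | bot => exact WithBot.bot_lt_coe _
  | coe d =>
    induction d with
    | top =>
      exfalso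
      have : ((n : ℕ∞) : WithBot ℕ∞) ≤ ((⊤ : ℕ∞) : WithBot ℕ∞) := WithBot.coe_le_coe.mpr le_top
      exact absurd h this.not_gt
    | coe d =>
      have h' : d < n := by exact_mod_cast h
      have : d + 1 < n + 1 := by omega
      exact_mod_cast this

lemma dlt_up {M : Type u} [AddCommGroup M] [Module R M] [Module.Finite R M] {n : ℕ} {r : R} (hr : r ∈ maximalIdeal R)
    (h : dlt R (QuotSMulTop r M) n) : dlt R M (n+1) := by
  unfold dlt at *
  refine (Module.supportDim_le_supportDim_quotSMulTop_succ hr).trans_lt ?_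
  exact succ_lt h

variable [IsAdicComplete (maximalIdeal R) R]

lemma nonvan_step (n : ℕ) (M : Type u) [AddCommGroup M] [Module R M] [Module.Finite R M] (hd : dlt R M (n+2))
    (hg0 : gam (maximalIdeal R) M = ⊥)
    (hg : gam (maximalIdeal R) (DD (R := R) (HH (maximalIdeal R) (n+1) M)) = ⊤) :
    ∃ r ∈ maximalIdeal R, IsSMulRegular M r ∧ gam (maximalIdeal R) (DD (R := R) (HH (maximalIdeal R) n (QuotSMulTop r M))) = ⊤ ∧
      (Subsingleton (HH (maximalIdeal R) n M) → Subsingleton (DD (R := R) (HH (maximalIdeal R) n (QuotSMulTop r M)))) := by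
  set m := maximalIdeal R with hm'
  let K := DD (R := R) (HH m n M)
  have hKf : Module.Finite R K := (finiteness m n M (Or.inl rfl)).2
  have hKq := gam_quot (M := K) m
  obtain ⟨r, hrm, hr⟩ := avoid m ((associatedPrimes.finite R M).union (associatedPrimes.finite R (K ⧸ gam m K)))
    (fun p hp => hp.elim (fun h => h.isPrime) (fun h => h.isPrime)) (fun p hp => hp.elim (fun h => ass_gam m hg0 h) (fun h => ass_gam m hKq h))
  have hr1 : IsSMulRegular M r := reg_of_notMem fun p hp => hr p (Or.inl hp)
  have hr2 : IsSMulRegular (K ⧸ gam m K) r := reg_of_notMem fun p hp => hr p (Or.inr hp)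
  obtain ⟨δ, h3, h4⟩ := les_d m n (lsmul_inj hr1) (Submodule.mkQ_surjective _) (qst_exact r)
  have hb := les_b m n (lsmul_inj hr1) (Submodule.mkQ_surjective _) (qst_exact r)
  have hv : Subsingleton (HH m (n+1) (QuotSMulTop r M)) := van m (n+1) _ (dlt_reg hr1 hd)
  have hdiv : Function.Surjective (hm m (n+1) (LinearMap.lsmul R M r)) :=
    les_fsurj m (n+1) (lsmul_inj hr1) (Submodule.mkQ_surjective _) (qst_exact r) hv
  have e1 : ∀ i, hm m i (LinearMap.lsmul R M r) = LinearMap.lsmul R (HH m i M) r := fun i =>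
        LinearMap.ext fun y => hm_lsmul m i r y
  rw [e1] at hdiv hb h4
  have hK0 : ∀ f : DD (R := R) (HH m (n+1) M), f = 0 := by
    have key : ∀ t (f : DD (R := R) (HH m (n+1) M)), r ^ t • f = 0 → f = 0 := by
      intro t
      induction t with
      | zero => intro y hy; rwa [pow_zero, one_smul] at hy
      | succ t iht =>
        intro y hy
        rw [pow_succ, mul_smul] at hy
        have := iht _ hy
        rw [← dm_lsmul] at this
        exact dm_inj hdiv (this.trans (map_zero _).symm)
    intro f
    obtain ⟨t, ht⟩ : f ∈ gam m _ := hg ▸ trivial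
    exact key t f (ht _ (Ideal.pow_mem_pow hrm t))
  have hinj : Function.Injective (dm (hm m n (Submodule.mkQ (r • (⊤ : Submodule R M))))) := by
    rw [injective_iff_map_eq_zero]
    intro f hf
    obtain ⟨g, rfl⟩ := (dm_exact h3 f).mp hf
    rw [hK0 g, map_zero]
  refine ⟨r, hrm, hr1, ?_, fun hs => ?_⟩
  · have himg : ∀ f, dm (hm m n (Submodule.mkQ (r • (⊤ : Submodule R M)))) f ∈ gam m K := by
      intro f
      have h5 := (dm_exact hb _).mpr ⟨f, rfl⟩
      rw [dm_lsmul] at h5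
      rw [← Submodule.Quotient.mk_eq_zero]
      apply hr2
      change r • _ = r • 0
      rw [smul_zero]
      exact (Submodule.Quotient.mk_smul (gam m K) r (x := dm (hm m n (Submodule.mkQ (r • (⊤ : Submodule R M)))) f)).symm.trans ((congrArg _ h5).trans (Submodule.Quotient.mk_zero _))
    exact gam_top_of_inj m (LinearMap.codRestrict _ _ himg) (fun x y h => hinj (congrArg Subtype.val h)) (gam_gam (M := K) m)
  · have := DD_sub (R := R) hs
    exact hinj.subsingleton

theorem nonvan (n : ℕ) : ∀ (M : Type u) [AddCommGroup M] [Module R M] [Module.Finite R M], dlt R M (n+2) →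
    gam (maximalIdeal R) (DD (R := R) (HH (maximalIdeal R) (n+1) M)) = ⊤ → dlt R M (n+1) := by
  induction n with
  | zero =>
    intro M _ _ _ hd hg
    apply dlt_mod_gam
    have hd := dlt_surj _ (Submodule.mkQ_surjective (gam (maximalIdeal R) M)) hd
    have hg0 := gam_quot (M := M) (maximalIdeal R)
    obtain ⟨e⟩ := HH_mod_gam (maximalIdeal R) 0 M
    have hg := gam_top_of_surj _ (dm e.symm.toLinearMap) (dm_surj e.symm.injective) hg
    obtain ⟨r, hrm, hr, h1, h2⟩ := nonvan_step 0 _ hd hg0 hg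
    have h3 : Subsingleton (HH (maximalIdeal R) 0 (M ⧸ gam (maximalIdeal R) M)) := by
      have : Subsingleton (gam (maximalIdeal R) (M ⧸ gam (maximalIdeal R) M)) := by
        rw [hg0]; infer_instance
      exact (evE _ _).injective.subsingleton
    have h4 := DD_faith (finiteness (maximalIdeal R) 0 _ (Or.inl rfl)).1 (h2 h3)
    refine dlt_up hrm ?_
    have h5 := gam_zero (dlt_reg hr hd)
    have h6 : Subsingleton (QuotSMulTop r (M ⧸ gam (maximalIdeal R) M)) := by
      have h7 := ev_range (maximalIdeal R) (QuotSMulTop r (M ⧸ gam (maximalIdeal R) M))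
      rw [h5, LinearMap.range_eq_top] at h7
      exact h7.subsingleton
    exact dlt_sub
  | succ n ih =>
    intro M _ _ _ hd hg
    apply dlt_mod_gam
    have hd := dlt_surj _ (Submodule.mkQ_surjective (gam (maximalIdeal R) M)) hd
    have hg0 := gam_quot (M := M) (maximalIdeal R)
    obtain ⟨e⟩ := HH_mod_gam (maximalIdeal R) (n+1) M
    have hg := gam_top_of_surj _ (dm e.symm.toLinearMap) (dm_surj e.symm.injective) hg
    obtain ⟨r, hrm, hr, h1, h2⟩ := nonvan_step (n+1) _ hd hg0 hg
    exact dlt_up hrm (ih _ (dlt_reg hr hd) h1)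

end
end LC
end

section
set_option linter.unusedSectionVars false
namespace LC
variable {R : Type u} [CommRing R]
open IsLocalRing Pointwise

section
variable [IsLocalRing R] [IsNoetherianRing R] 

/-- some prime other than the maximal ideal contains both -/
def bad (a q : Ideal R) : Prop := ∃ p : Ideal R, p.IsPrime ∧ p ≠ maximalIdeal R ∧ a ≤ p ∧ q ≤ p

lemma bad_mono {a q q' : Ideal R} (h : q ≤ q') (hb : bad a q') : bad a q := by
  obtain ⟨p, h1, h2, h3, h4⟩ := hb
  exact ⟨p, h1, h2, h3, h.trans h4⟩

lemma hm_kill {a : Ideal R} {n : ℕ} {N : Type u} [AddCommGroup N] [Module R N] {s : R} (h : ∀ x : N, s • x = 0) (y : HH a n N) : s • y = 0 := by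
  rw [← hm_lsmul]
  have : LinearMap.lsmul R N s = 0 := LinearMap.ext h
  rw [this, hm_zero]; rfl

lemma equiv_kill {A B : Type u} [AddCommGroup A] [Module R A] [AddCommGroup B] [Module R B] (e : A ≃ₗ[R] B) {s : R}
    (h : ∀ x : A, s • x = 0) (y : B) : s • y = 0 := by
  obtain ⟨x, rfl⟩ := e.surjective y
  rw [← map_smul, h, map_zero]

lemma kill_of (a : Ideal R) (n : ℕ) (H : ∀ q : Ideal R, q.IsPrime → dlt R (R ⧸ q) (n+1) → bad a q → Subsingleton (HH a n (R ⧸ q)))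
    (Q : Ideal R) (hQ : Q.IsPrime) (hb : bad a Q) (N : Type u) [AddCommGroup N] [Module R N] [hN : Module.Finite R N] (hd : dlt R N (n+1)) :
    ∃ s ∉ Q, ∀ x : HH a n N, s • x = 0 := by
  have h1 : (1 : R) ∉ Q := (Ideal.ne_top_iff_one _).mp hQ.ne_top
  revert hd
  induction hN using IsNoetherianRing.induction_on_isQuotientEquivQuotientPrime R with
  | subsingleton N =>
    intro hd
    have := HH_sub (M := N) a n
    exact ⟨1, h1, fun x => Subsingleton.elim _ _⟩
  | quotient N p e =>
    intro hd
    by_cases hp : p.asIdeal ≤ Q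
    · have := H p.asIdeal p.2 (dlt_surj e.toLinearMap e.surjective hd) (bad_mono hp hb)
      refine ⟨1, h1, fun x => (hme a n e).injective (Subsingleton.elim _ _)⟩
    · obtain ⟨s, hs, hsQ⟩ := Set.not_subset.mp hp
      refine ⟨s, hsQ, hm_kill fun x => e.injective ?_⟩
      rw [map_smul, map_zero]
      obtain ⟨y, hy⟩ := Ideal.Quotient.mk_surjective (e x)
      rw [← hy, Algebra.smul_def]
      change Ideal.Quotient.mk _ s * _ = 0
      rw [Ideal.Quotient.eq_zero_iff_mem.mpr hs, zero_mul]
  | exact N1 N2 N3 f g hf hg hfg ih1 ih3 =>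
    intro hd
    obtain ⟨s1, hs1, h1⟩ := ih1 (dlt_inj f hf hd)
    obtain ⟨s3, hs3, h3⟩ := ih3 (dlt_surj g hg hd)
    refine ⟨s1 * s3, fun h => (hQ.mem_or_mem h).elim hs1 hs3, fun x => ?_⟩
    have : hm a n g (s3 • x) = 0 := by rw [map_smul, h3]
    obtain ⟨z, hz⟩ := (les_b a n hf hg hfg _).mp this
    rw [mul_smul, ← hz, ← map_smul, h1, map_zero]

lemma det_trick {K : Type u} [AddCommGroup K] [Module R K] [Module.Finite R K] (p : Ideal R) (hp : p.IsPrime) {r s : R} (hr : r ∈ p) (hs : s ∉ p)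
    (h : ∀ f : K, ∃ g : K, s • f = r • g) : ∃ c ∉ p, ∀ f : K, c • f = 0 := by
  obtain ⟨P, hP1, -, hP2, hP3⟩ := LinearMap.exists_monic_and_natDegree_eq_and_coeff_mem_pow_and_aeval_eq_zero R (LinearMap.lsmul R K s) p (by
    rintro _ ⟨f, rfl⟩
    obtain ⟨g, hg⟩ := h f
    change s • f ∈ _
    rw [hg]
    exact Submodule.smul_mem_smul hr trivial)
  refine ⟨P.eval s, ?_, fun f => ?_⟩
  · rw [Polynomial.eval_eq_sum_range, Finset.sum_range_succ, hP1.coeff_natDegree, one_mul]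
    intro h
    have h2 : ∑ x ∈ Finset.range P.natDegree, P.coeff x * s ^ x ∈ p := by
      refine Ideal.sum_mem _ fun i hi => Ideal.mul_mem_right _ _ ?_
      have h3 := hP2 i
      rw [Finset.mem_range] at hi
      exact Ideal.pow_le_self (by omega) h3
    exact hs (hp.mem_of_pow_mem _ ((Ideal.add_mem_iff_right _ h2).mp h))
  · have h1 : LinearMap.lsmul R K s = algebraMap R (Module.End R K) s := rfl
    rw [h1, Polynomial.aeval_algebraMap_apply] at hP3
    exact LinearMap.congr_fun hP3 f

variable [IsAdicComplete (maximalIdeal R) R]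

lemma smul_quot_reg {q : Ideal R} (hq : q.IsPrime) {r : R} (hr : r ∉ q) : IsSMulRegular (R ⧸ q) r := by
  intro x y h
  obtain ⟨x, rfl⟩ := Ideal.Quotient.mk_surjective x
  obtain ⟨y, rfl⟩ := Ideal.Quotient.mk_surjective y
  have h : Ideal.Quotient.mk q (r * x) = Ideal.Quotient.mk q (r * y) := h
  rw [Ideal.Quotient.eq, ← mul_sub] at h
  rw [Ideal.Quotient.eq]
  exact (hq.mem_or_mem h).resolve_left hr

theorem LH (a : Ideal R) (n : ℕ) : ∀ q : Ideal R, q.IsPrime → dlt R (R ⧸ q) (n+1) → bad a q → Subsingleton (HH a n (R ⧸ q)) := by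
  induction n with
  | zero =>
    intro q hq hd hb
    exfalso
    obtain ⟨p, h1, h2, h3, h4⟩ := hb
    refine not_dlt_iff.mpr ⟨⟨1, ![⟨⟨p, h1⟩, (mem_supp_quot _ _).mpr h4⟩, ⟨⟨maximalIdeal R, inferInstance⟩, (mem_supp_quot _ _).mpr (le_maximalIdeal hq.ne_top)⟩], ?_⟩, rfl⟩ hd
    intro i
    fin_cases i
    exact lt_of_le_of_ne (le_maximalIdeal h1.ne_top) h2
  | succ n ih =>
    intro q hq hd hb
    by_cases haq : a ≤ q
    · exact vanish_tors a n _ (gam_ann a (by rwa [Ideal.annihilator_quotient]))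
    obtain ⟨r, hra, hrq⟩ := Set.not_subset.mp haq
    obtain ⟨p, h1, h2, h3, h4⟩ := hb
    have hr := smul_quot_reg hq hrq
    obtain ⟨s, hsp, hs⟩ := kill_of a n ih p h1 ⟨p, h1, h2, h3, le_rfl⟩ (QuotSMulTop r (R ⧸ q)) (dlt_reg hr hd)
    obtain ⟨hf1, hf2⟩ := finiteness a (n+1) (R ⧸ q) (Or.inr hd)
    refine DD_faith hf1 ?_
    have htf : ∀ x ∉ q, ∀ f : DD (R := R) (HH a (n+1) (R ⧸ q)), x • f = 0 → f = 0 := by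
      intro x hx f hxf
      have hx' := smul_quot_reg hq hx
      have hv := van a (n+1) (QuotSMulTop x (R ⧸ q)) (dlt_reg hx' hd)
      have hdiv := les_fsurj a (n+1) (lsmul_inj hx') (Submodule.mkQ_surjective _) (qst_exact x) hv
      have e1 : hm a (n+1) (LinearMap.lsmul R (R ⧸ q) x) = LinearMap.lsmul R (HH a (n+1) (R ⧸ q)) x :=
        LinearMap.ext fun y => hm_lsmul a (n+1) x y
      rw [e1] at hdiv
      rw [← dm_lsmul] at hxf
      exact dm_inj hdiv (hxf.trans (map_zero _).symm)
    obtain ⟨δ, -, h6⟩ := les_d a n (lsmul_inj hr) (Submodule.mkQ_surjective _) (qst_exact r)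
    have e1 : hm a (n+1) (LinearMap.lsmul R (R ⧸ q) r) = LinearMap.lsmul R (HH a (n+1) (R ⧸ q)) r :=
        LinearMap.ext fun y => hm_lsmul a (n+1) r y
    rw [e1] at h6
    obtain ⟨c, hcp, hc⟩ := det_trick p h1 (h3 hra) hsp (K := DD (R := R) (HH a (n+1) (R ⧸ q))) (by
      intro f
      have : dm δ (s • f) = 0 := by
        ext z
        change s • f (δ z) = 0
        rw [← map_smul, ← map_smul]
        exact (congrArg (fun w => f (δ w)) (hs z)).trans (by simp)
      obtain ⟨g, hg⟩ := (dm_exact h6 _).mp this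
      exact ⟨g, by rw [← hg, dm_lsmul]⟩)
    have h0 : ∀ f : DD (R := R) (HH a (n+1) (R ⧸ q)), f = 0 := fun f => htf c (fun h => hcp (h4 h)) f (hc f)
    exact ⟨fun x y => (h0 x).trans (h0 y).symm⟩

theorem kill (a : Ideal R) (n : ℕ) 
    (Q : Ideal R) (hQ : Q.IsPrime) (hb : bad a Q) (N : Type u) [AddCommGroup N] [Module R N] [hN : Module.Finite R N] (hd : dlt R N (n+1)) :
    ∃ s ∉ Q, ∀ x : HH a n N, s • x = 0 := kill_of a n (LH a n) Q hQ hb N hd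

theorem LHV (a : Ideal R) (n : ℕ) (N : Type u) [AddCommGroup N] [Module R N] [hN : Module.Finite R N] (hd : dlt R N (n+1))
    (H : ∀ q ∈ Module.support R N, ¬ dlt R (R ⧸ q.asIdeal) n → bad a q.asIdeal) : Subsingleton (HH a n N) := by
  revert hd H
  induction hN using IsNoetherianRing.induction_on_isQuotientEquivQuotientPrime R with
  | subsingleton N => intro hd H; exact HH_sub a n
  | quotient N p e =>
    intro hd H
    refine ((hme a n e).toEquiv.subsingleton_congr).mpr ?_
    have hd' := dlt_surj e.toLinearMap e.surjective hd
    by_cases h : dlt R (R ⧸ p.asIdeal) n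
    · exact van a n _ h
    · exact LH a n _ p.2 hd' (H p (by rw [LinearEquiv.support_eq e, mem_supp_quot]) h)
  | exact N1 N2 N3 f g hf hg hfg ih1 ih3 =>
    intro hd H
    exact les_mid_sub a n hf hg hfg 
      (ih1 (dlt_inj f hf hd) fun q hq => H q (Module.support_subset_of_injective f hf hq))
      (ih3 (dlt_surj g hg hd) fun q hq => H q (Module.support_subset_of_surjective g hg hq))
end
end LC
end

section
set_option linter.unusedSectionVars false
namespace LC
variable {R : Type u} [CommRing R]
open IsLocalRing Pointwise

lemma dlt_lt {p q : Ideal R} (hp : p.IsPrime) (hq : q.IsPrime) (h : q < p) {n : ℕ} (hd : dlt R (R ⧸ q) (n+1)) :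
    dlt R (R ⧸ p) n := by
  by_contra h2
  obtain ⟨l, hl⟩ := not_dlt_iff.mp h2
  have hh : ∀ x : Module.support R (R ⧸ p), p ≤ x.1.asIdeal := fun x => (mem_supp_quot _ _).mp x.2
  let l' : LTSeries (Module.support R (R ⧸ q)) :=
    l.map (fun x => ⟨x.1, (mem_supp_quot _ _).mpr (h.le.trans (hh x))⟩) (fun _ _ h => h)
  refine not_dlt_iff.mpr ⟨l'.cons ⟨⟨q, hq⟩, (mem_supp_quot _ _).mpr le_rfl⟩ ?_, ?_⟩ hd
  · have : q < l.head.1.asIdeal := lt_of_lt_of_le h (hh _)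
    exact this
  · refine (RelSeries.cons_length _ _ _).trans ?_
    exact congrArg (· + 1) hl

def ash (R : Type u) [CommRing R] (M : Type u) [AddCommGroup M] [Module R M] (n : ℕ) : Set (Ideal R) :=
  {p | ∃ h : p.IsPrime, (⟨p, h⟩ : PrimeSpectrum R) ∈ Module.support R M ∧ ¬ dlt R (R ⧸ p) n}

section
variable {M : Type u} [AddCommGroup M] [Module R M] {n : ℕ}

lemma ash_min (hd : dlt R M (n+1)) {p q : Ideal R} (hp : p ∈ ash R M n) (hq : q.IsPrime)
    (hs : (⟨q, hq⟩ : PrimeSpectrum R) ∈ Module.support R M) (h : q ≤ p) : q = p := by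
  by_contra hne
  obtain ⟨h1, h2, h3⟩ := hp
  have h4 : dlt R (R ⧸ q) (n+1) := dlt_iff.mp hd ⟨q, hq⟩ hs
  have h5 : dlt R (R ⧸ p) n := dlt_lt h1 hq (lt_of_le_of_ne h hne) h4
  exact h3 h5

lemma ash_ass [IsNoetherianRing R] [Module.Finite R M] (hd : dlt R M (n+1)) {p : Ideal R} (hp : p ∈ ash R M n) :
    p ∈ associatedPrimes R M := by
  apply Module.associatedPrimes.minimalPrimes_annihilator_subset_associatedPrimes
  have hp' := hp
  obtain ⟨h1, h2, h3⟩ := hp'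
  refine ⟨⟨h1, Module.mem_support_iff_of_finite.mp h2⟩, fun q hq hle => ?_⟩
  exact (ash_min hd hp hq.1 (Module.mem_support_iff_of_finite.mpr hq.2) hle).ge

lemma ash_fin [IsNoetherianRing R] [Module.Finite R M] (hd : dlt R M (n+1)) : (ash R M n).Finite :=
  (associatedPrimes.finite R M).subset fun _ hp => ash_ass hd hp

lemma ass_supp [Module.Finite R M] {p : Ideal R} (hp : p ∈ associatedPrimes R M) :
   (⟨p, IsAssociatedPrime.isPrime hp⟩ : PrimeSpectrum R) ∈ Module.support R M := by
  rw [Module.mem_support_iff_of_finite]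
  exact le_of_eq_of_le Submodule.annihilator_top.symm (IsAssociatedPrime.annihilator_le hp)

end

section
variable [IsLocalRing R]

lemma rad_eq {I : Ideal R} (hI : I ≤ maximalIdeal R) (h : ∀ P : Ideal R, P.IsPrime → I ≤ P → P = maximalIdeal R) :
    I.radical = (maximalIdeal R).radical := by
  have : (maximalIdeal R).IsPrime := inferInstance
  rw [this.radical]
  apply le_antisymm
  · exact this.radical_le_iff.mpr hI
  · rw [Ideal.radical_eq_sInf]
    exact le_sInf fun P hP => (h P hP.2 hP.1).ge

variable [IsNoetherianRing R]

lemma dim_one [IsDomain R] {x : R} (hx : x ≠ 0) (hxm : x ∈ maximalIdeal R)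
   (h : ∀ P : Ideal R, P.IsPrime → P ≠ ⊥ → x ∈ P) (P : Ideal R) (hP : P.IsPrime) (h0 : P ≠ ⊥) : P = maximalIdeal R := by
  have hm : maximalIdeal R ∈ (Ideal.span {x}).minimalPrimes := by
    by_contra hne
    obtain ⟨y, hy, hyp⟩ := avoid (maximalIdeal R) (Ideal.finite_minimalPrimes_of_isNoetherianRing R (Ideal.span {x}))
      (fun p hp => hp.1.1) (fun p hp hle => hne (by
        rwa [le_antisymm hle (le_maximalIdeal hp.1.1.ne_top)]))
    have h1 : Ideal.span {y} ≤ maximalIdeal R := (Ideal.span_singleton_le_iff_mem _).mpr hy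
    obtain ⟨Q, hQ, -⟩ := Ideal.exists_minimalPrimes_le h1
    have hQp : Q.IsPrime := hQ.1.1
    have hyQ : y ∈ Q := hQ.1.2 (Ideal.mem_span_singleton_self y)
    obtain ⟨p0, hp0, -⟩ := Ideal.exists_minimalPrimes_le ((Ideal.span_singleton_le_iff_mem (maximalIdeal R)).mpr hxm)
    have hxp0 : x ∈ p0 := hp0.1.2 (Ideal.mem_span_singleton_self x)
    have hy0 : y ≠ 0 := fun h => hyp p0 hp0 (h ▸ p0.zero_mem)
    have hxQ : x ∈ Q := h Q hQp (fun h => hy0 (by rw [h] at hyQ; simpa using hyQ))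
    obtain ⟨p1, hp1, hle⟩ := Ideal.exists_minimalPrimes_le ((Ideal.span_singleton_le_iff_mem Q).mpr hxQ)
    have hp1p : p1.IsPrime := hp1.1.1
    have hlt : p1 < Q := lt_of_le_of_ne hle (fun h => hyp p1 hp1 (h ▸ hyQ))
    have hh := Ideal.height_le_one_of_isPrincipal_of_mem_minimalPrimes (Ideal.span {y}) Q hQ
    have h2 := (Ideal.height_le_iff (n := 1)).mp (by exact_mod_cast hh) p1 hp1p hlt
    have hb : (⊥ : Ideal R) < p1 := bot_lt_iff_ne_bot.mpr fun h => hx (by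
      have := hp1.1.2 (Ideal.mem_span_singleton_self x)
      rw [h] at this; simpa using this)
    have hbp : (⊥ : Ideal R).IsPrime := Ideal.isPrime_bot
    have h3 := Ideal.height_strict_mono_of_isPrime_of_isPrime hb
    have h4 : p1.height = 0 := Order.lt_one_iff.mp (by exact_mod_cast h2)
    rw [h4] at h3
    exact not_lt_zero h3
  have hx' := h P hP h0
  exact le_antisymm (le_maximalIdeal hP.ne_top) (hm.2 ⟨hP, (Ideal.span_singleton_le_iff_mem _).mpr hx'⟩ (le_maximalIdeal hP.ne_top))

lemma curve {p : Ideal R} (hp : p.IsPrime) {x : R} (hx : x ∉ p) (hxm : x ∈ maximalIdeal R) :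
    ∃ Q : Ideal R, Q.IsPrime ∧ p ≤ Q ∧ x ∉ Q ∧ ∀ P : Ideal R, P.IsPrime → Q ≤ P → P ≠ Q → P = maximalIdeal R := by
  obtain ⟨Q, ⟨hQ, hpQ, hxQ⟩, hmax⟩ := set_has_maximal_iff_noetherian.mpr (inferInstance : IsNoetherianRing R)
    {Q : Ideal R | Q.IsPrime ∧ p ≤ Q ∧ x ∉ Q} ⟨p, hp, le_rfl, hx⟩
  refine ⟨Q, hQ, hpQ, hxQ, fun P hP hle hne => ?_⟩
  have : IsDomain (R ⧸ Q) := Ideal.Quotient.isDomain Q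
  have : IsLocalRing (R ⧸ Q) := IsLocalRing.of_surjective' (Ideal.Quotient.mk Q) Ideal.Quotient.mk_surjective
  have hker : RingHom.ker (Ideal.Quotient.mk Q) = Q := Ideal.mk_ker
  have hcm : ∀ J : Ideal R, Q ≤ J → (J.map (Ideal.Quotient.mk Q)).comap (Ideal.Quotient.mk Q) = J := fun J hJ => by
    rw [Ideal.comap_map_of_surjective' _ Ideal.Quotient.mk_surjective, hker, sup_eq_left.mpr hJ]
  have hloc : (maximalIdeal (R ⧸ Q)).comap (Ideal.Quotient.mk Q) = maximalIdeal R := by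
    have : ((maximalIdeal (R ⧸ Q)).comap (Ideal.Quotient.mk Q)).IsMaximal :=
      Ideal.comap_isMaximal_of_surjective _ Ideal.Quotient.mk_surjective
    exact IsLocalRing.eq_maximalIdeal this
  have key := dim_one (R := R ⧸ Q) (x := Ideal.Quotient.mk Q x)
    (fun h => hxQ (Ideal.Quotient.eq_zero_iff_mem.mp h))
    (by rw [← hloc] at hxm; exact hxm)
    (fun P' hP' h0 => by
      by_contra hn
      have h1 : Q ≤ P'.comap (Ideal.Quotient.mk Q) := by
        exact hker.symm.le.trans (Ideal.comap_mono bot_le)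
      refine hmax (P'.comap (Ideal.Quotient.mk Q)) ⟨Ideal.comap_isPrime _ _, hpQ.trans h1, hn⟩ (lt_of_le_of_ne h1 fun he => h0 ?_)
      rw [← Ideal.map_comap_of_surjective _ Ideal.Quotient.mk_surjective P', ← he]
      exact Ideal.map_quotient_self Q)
    (P.map (Ideal.Quotient.mk Q)) 
    (Ideal.map_isPrime_of_surjective Ideal.Quotient.mk_surjective (by rwa [hker]))
    (fun h => hne (by rw [← hcm P hle, h]; exact hker))
  rw [← hcm P hle, key, hloc]

def TT (M : Type u) [AddCommGroup M] [Module R M] (n : ℕ) (a : Ideal R) : Set (Ideal R) :=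
  {p ∈ ash R M n | a ≤ maximalIdeal R ∧ ¬ bad a p}

variable {M : Type u} [AddCommGroup M] [Module R M] [Module.Finite R M] {n : ℕ}

lemma realize (hn : 1 ≤ n) (hd : dlt R M (n+1)) (T : Set (Ideal R)) (hT : T ⊆ ash R M n) : ∃ a : Ideal R, TT M n a = T := by
  classical
  have hne : ∀ p ∈ ash R M n, p ≠ maximalIdeal R := by
    rintro p ⟨-, -, h⟩ rfl
    exact h (dlt_mono hn dlt_field)
  have hTf := (ash_fin hd).subset hT
  have ex : ∀ p, ∃ Q : Ideal R, p ∈ ash R M n \ T → Q.IsPrime ∧ p ≤ Q ∧ Q ≠ maximalIdeal R ∧ (∀ p' ∈ T, ¬ p' ≤ Q) ∧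
      ∀ P : Ideal R, P.IsPrime → Q ≤ P → P ≠ Q → P = maximalIdeal R := by
    intro p
    by_cases hp : p ∈ ash R M n \ T
    swap
    · exact ⟨⊥, fun h => absurd h hp⟩
    have hpp : p.IsPrime := hp.1.1
    have : ¬ (maximalIdeal R ⊓ hTf.toFinset.inf id ≤ p) := by
      intro h
      rcases hpp.inf_le.mp h with h | h
      · exact hne p hp.1 (le_antisymm (le_maximalIdeal hpp.ne_top) h)
      · obtain ⟨p', hp', hle⟩ := hpp.inf_le'.mp h
        have hp'T : p' ∈ T := by simpa using hp'
        have := ash_min hd hp.1 (hT hp'T).1 (hT hp'T).2.1 hle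
        exact hp.2 (this ▸ hp'T)
    obtain ⟨x, hx, hxp⟩ := SetLike.not_le_iff_exists.mp this
    obtain ⟨Q, h1, h2, h3, h4⟩ := curve hpp hxp hx.1
    refine ⟨Q, fun _ => ⟨h1, h2, fun h => h3 (h ▸ hx.1), fun p' hp' hle => h3 (hle ?_), h4⟩⟩
    exact (Finset.inf_le (f := id) (hTf.mem_toFinset.mpr hp') : _ ≤ p') hx.2
  choose Q hQ using ex
  have hUf := (ash_fin hd).subset (Set.sdiff_subset (t := T))
  refine ⟨maximalIdeal R ⊓ hUf.toFinset.inf Q, ?_⟩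
  ext p
  constructor
  · rintro ⟨h1, h2, h3⟩
    by_contra hpT
    obtain ⟨q1, q2, q3, -, -⟩ := hQ p ⟨h1, hpT⟩
    exact h3 ⟨Q p, q1, q3, inf_le_right.trans (Finset.inf_le (hUf.mem_toFinset.mpr ⟨h1, hpT⟩)), q2⟩
  · intro hp
    refine ⟨hT hp, inf_le_left, ?_⟩
    rintro ⟨P, hP, hPm, h1, h2⟩
    rcases hP.inf_le.mp h1 with h | h
    · exact hPm (le_antisymm (le_maximalIdeal hP.ne_top) h)
    · obtain ⟨p', hp', hle⟩ := hP.inf_le'.mp h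
      obtain ⟨q1, q2, q3, q4, q5⟩ := hQ p' (hUf.mem_toFinset.mp hp')
      by_cases hPQ : P = Q p'
      · exact q4 p hp (hPQ ▸ h2)
      · exact hPm (q5 P hP hle hPQ)
end
end LC
end

section
set_option linter.unusedSectionVars false
namespace LC
variable {R : Type u} [CommRing R]
open IsLocalRing Pointwise

/-- elements outside all primes in `T` -/
def SS (T : Set (Ideal R)) : Submonoid R where
  carrier := {s | ∀ p ∈ T, p.IsPrime → s ∉ p}
  one_mem' := fun p _ hp h => hp.ne_top ((Ideal.eq_top_iff_one p).mpr h)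
  mul_mem' := fun {x y} hx hy p hpT hp h => (hp.mem_or_mem h).elim (hx p hpT hp) (hy p hpT hp)

def NT (M : Type u) [AddCommGroup M] [Module R M] (T : Set (Ideal R)) : Submodule R M := Submodule.torsion' R M (SS T)

lemma mem_NT {M : Type u} [AddCommGroup M] [Module R M] {T : Set (Ideal R)} {x : M} :
    x ∈ NT M T ↔ ∃ s ∈ SS T, s • x = 0 := by
  unfold NT
  rw [Submodule.mem_torsion'_iff]
  exact ⟨fun ⟨a, h⟩ => ⟨a.1, a.2, h⟩, fun ⟨a, h1, h⟩ => ⟨⟨a, h1⟩, h⟩⟩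

variable [IsLocalRing R] [IsNoetherianRing R] [IsAdicComplete (maximalIdeal R) R]
variable {M : Type u} [AddCommGroup M] [Module R M] [Module.Finite R M] {n : ℕ}

lemma supp_sub (N : Submodule R M) : Module.support R N ⊆ Module.support R M :=
  Module.support_subset_of_injective N.subtype N.injective_subtype

lemma supp_quo (N : Submodule R M) : Module.support R (M ⧸ N) ⊆ Module.support R M :=
  Module.support_subset_of_surjective N.mkQ N.mkQ_surjective

lemma NT_sub (hd : dlt R M (n+1)) (a : Ideal R) : Subsingleton (HH a n (NT M (TT M n a))) := by
  by_cases ha : a = ⊤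
  · subst ha; exact HH_top _
  have ham := le_maximalIdeal ha
  refine LHV a n _ (dlt_inj _ (Submodule.injective_subtype _) hd) fun q hq hqd => ?_
  by_contra hb
  have hqT : q.asIdeal ∈ TT M n a := ⟨⟨q.2, supp_sub _ hq, hqd⟩, ham, hb⟩
  refine Module.notMem_support_iff'.mpr (fun x => ?_) hq
  obtain ⟨s, hs, hx⟩ := mem_NT.mp x.2
  exact ⟨s, hs _ hqT q.2, Subtype.ext hx⟩

lemma ass_quo (hd : dlt R M (n+1)) {T : Set (Ideal R)} (hT : T ⊆ ash R M n) {p : Ideal R} 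
    (hp : p ∈ associatedPrimes R (M ⧸ NT M T)) : p ∈ T := by
  have hs := supp_quo _ (ass_supp hp)
  have hpp : p.IsPrime := hp.isPrime
  suffices ∃ q ∈ T, p ≤ q by
    obtain ⟨q, hq, hle⟩ := this
    rwa [ash_min hd (hT hq) hpp hs hle]
  by_contra! hcon
  obtain ⟨s, hsp, hsT⟩ := avoid p ((ash_fin hd).subset hT) (fun q hq => (hT hq).1) hcon
  obtain ⟨-, x, hx⟩ := (isAssociatedPrime_iff).mp hp
  obtain ⟨y, rfl⟩ := Submodule.mkQ_surjective _ x
  have h0 : s • (NT M T).mkQ y = 0 := by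
    rw [hx] at hsp
    simpa using hsp
  rw [← map_smul, Submodule.mkQ_apply, Submodule.Quotient.mk_eq_zero] at h0
  obtain ⟨t, ht, hty⟩ := mem_NT.mp h0
  have hy : y ∈ NT M T := mem_NT.mpr ⟨t * s, mul_mem ht (fun q hq _ => hsT q hq), by rw [mul_smul, hty]⟩
  have : (NT M T).mkQ y = 0 := by rw [Submodule.mkQ_apply]; exact (Submodule.Quotient.mk_eq_zero _).mpr hy
  apply hpp.ne_top
  rw [hx, this]
  ext z; simp

theorem struct (hn : 1 ≤ n) (hd : dlt R M (n+1)) (a : Ideal R) :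
    Nonempty (HH a n M ≃ₗ[R] HH (maximalIdeal R) n (M ⧸ NT M (TT M n a))) := by
  set T := TT M n a with hTdef
  have hT : T ⊆ ash R M n := fun p hp => hp.1
  have e1 : Nonempty (HH a n M ≃ₗ[R] HH a n (M ⧸ NT M T)) := ⟨LinearEquiv.ofBijective (hm a n (NT M T).mkQ)
    ⟨les_inj a n (Submodule.injective_subtype _) (Submodule.mkQ_surjective _) (LinearMap.exact_subtype_mkQ _) (NT_sub hd a),
     les_surj a n (Submodule.injective_subtype _) (Submodule.mkQ_surjective _) (LinearMap.exact_subtype_mkQ _)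
      (van a (n+1) _ (dlt_inj _ (Submodule.injective_subtype _) hd))⟩⟩
  obtain ⟨e1⟩ := e1
  rcases subsingleton_or_nontrivial (M ⧸ NT M T) with h | h
  · have h1 : Subsingleton (HH a n (M ⧸ NT M T)) := HH_sub a n
    have h2 : Subsingleton (HH (maximalIdeal R) n (M ⧸ NT M T)) := HH_sub _ n
    have h3 : Subsingleton (HH a n M) := e1.toEquiv.subsingleton
    exact ⟨e1.trans ⟨0, 0, fun x => Subsingleton.elim _ _, fun x => Subsingleton.elim _ _⟩⟩
  · obtain ⟨q, hq⟩ := associatedPrimes.nonempty R (M ⧸ NT M T)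
    have hqT := ass_quo hd hT hq
    obtain ⟨e2⟩ := HH_rad_sup (a := a) (b := maximalIdeal R) (n := n) hn (M := M ⧸ NT M T) le_rfl (rad_eq (sup_le hqT.2.1 
      ((Module.mem_support_iff_of_finite.mp (ass_supp hq)).trans (le_maximalIdeal hq.isPrime.ne_top))) fun P hP hle => by
        obtain ⟨p, hp, hpP⟩ := Ideal.exists_minimalPrimes_le (le_sup_right.trans hle)
        have hpT := ass_quo hd hT (Module.associatedPrimes.minimalPrimes_annihilator_subset_associatedPrimes _ _ hp)
        by_contra hne
        exact hpT.2.2 ⟨P, hP, hne, le_sup_left.trans hle, hpP⟩)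
    exact ⟨e1.trans e2⟩

lemma distinct (hn : 1 ≤ n) (hd : dlt R M (n+1)) {a b : Ideal R} (e : HH a n M ≃ₗ[R] HH b n M) : TT M n a ⊆ TT M n b := by
  intro p hp
  by_contra hpb
  have hpp : p.IsPrime := hp.1.1
  have h1 : ∃ s ∉ p, ∀ x : HH b n M, s • x = 0 := by
    by_cases hb : b = ⊤
    · subst hb
      refine ⟨1, fun h => hpp.ne_top ((Ideal.eq_top_iff_one p).mpr h), fun x => ?_⟩
      have : Subsingleton (HH (⊤ : Ideal R) n M) := HH_top _
      exact Subsingleton.elim _ _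
    · refine kill b n p hpp ?_ M hd
      by_contra h
      exact hpb ⟨hp.1, le_maximalIdeal hb, h⟩
  obtain ⟨s, hs, hk⟩ := h1
  have hka : ∀ x : HH a n M, s • x = 0 := fun x => e.injective (by rw [map_smul, hk, map_zero])
  let N : Submodule R M := p • ⊤
  have hsurj : Function.Surjective (hm a n N.mkQ) :=
    les_surj a n (Submodule.injective_subtype _) (Submodule.mkQ_surjective _) (LinearMap.exact_subtype_mkQ _)
      (van a (n+1) _ (dlt_inj _ (Submodule.injective_subtype _) hd))
  have hkA : ∀ x : HH a n (M ⧸ N), s • x = 0 := fun x => by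
    obtain ⟨y, rfl⟩ := hsurj x
    rw [← map_smul, hka, map_zero]
  have hann : p ≤ Module.annihilator R (M ⧸ N) := by
    intro r hr
    rw [Module.mem_annihilator]
    intro x
    obtain ⟨y, rfl⟩ := Submodule.mkQ_surjective _ x
    rw [← map_smul, Submodule.mkQ_apply, Submodule.Quotient.mk_eq_zero]
    exact Submodule.smul_mem_smul hr trivial
  obtain ⟨e2⟩ := HH_rad_sup (a := a) (b := maximalIdeal R) (n := n) hn (M := M ⧸ N) hann (rad_eq (sup_le hp.2.1 
      (le_maximalIdeal hpp.ne_top)) fun P hP hle => by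
        by_contra hne
        exact hp.2.2 ⟨P, hP, hne, le_sup_left.trans hle, le_sup_right.trans hle⟩)
  have hkm : ∀ x : HH (maximalIdeal R) n (M ⧸ N), s • x = 0 := fun x => e2.symm.injective (by rw [map_smul, hkA, map_zero])
  have hdA : dlt R (M ⧸ N) (n+1) := dlt_surj _ (Submodule.mkQ_surjective _) hd
  have hpA : (⟨p, hpp⟩ : PrimeSpectrum R) ∈ Module.support R (M ⧸ N) := by
    rw [Module.support_quotient]
    exact ⟨hp.1.2.1, fun _ h => h⟩
  have hpl := Module.mem_support_iff_of_finite.mp hpA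
  have hmin : ∀ q ∈ (Module.annihilator R (M ⧸ N)).minimalPrimes, s ∉ q := by
    intro q hq
    have h1 : p ≤ q := hann.trans hq.1.2
    have h2 : q ≤ p := hq.2 ⟨hpp, hpl⟩ h1
    rwa [le_antisymm h2 h1]
  have hdq : dlt R (QuotSMulTop s (M ⧸ N)) n := dlt_min hmin hdA
  have hv := van (maximalIdeal R) n _ hdq
  let f := LinearMap.lsmul R (M ⧸ N) s
  have f1 : Function.Surjective (hm (maximalIdeal R) n f.rangeRestrict) :=
    les_surj _ n (f := (LinearMap.ker f).subtype) (Submodule.injective_subtype _) (LinearMap.surjective_rangeRestrict f)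
      (by rw [LinearMap.exact_iff, LinearMap.ker_rangeRestrict, Submodule.range_subtype])
      (van _ (n+1) _ (dlt_inj _ (Submodule.injective_subtype _) hdA))
  have f2 : Function.Surjective (hm (maximalIdeal R) n (LinearMap.range f).subtype) :=
    les_fsurj _ n (g := Submodule.mkQ (s • (⊤ : Submodule R (M ⧸ N)))) (Submodule.injective_subtype _) (Submodule.mkQ_surjective _)
      (by 
        have := (LinearMap.exact_iff.mp (qst_exact (M := M ⧸ N) s))
        rw [LinearMap.exact_iff, this, Submodule.range_subtype]) hv
  have hsub : Subsingleton (HH (maximalIdeal R) n (M ⧸ N)) := by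
    refine ⟨fun x y => ?_⟩
    have : ∀ x : HH (maximalIdeal R) n (M ⧸ N), x = 0 := fun x => by
      obtain ⟨y, rfl⟩ := f2 x
      obtain ⟨z, rfl⟩ := f1 y
      rw [← LinearMap.comp_apply, ← hm_comp, LinearMap.subtype_comp_codRestrict]
      exact (hm_lsmul _ n s z).trans (hkm z)
    rw [this x, this y]
  obtain ⟨k, rfl⟩ : ∃ k, n = k + 1 := ⟨n - 1, by omega⟩
  have hDD := DD_sub (R := R) hsub
  exact hp.1.2.2 (dlt_iff.mp (nonvan k (M ⧸ N) hdA (gam_sub _)) ⟨p, hpp⟩ hpA)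
end LC
end

section
namespace LC
open IsLocalRing

lemma assh_eq {R : Type u} [CommRing R] [IsNoetherianRing R] {M : Type u} [AddCommGroup M] [Module R M] [Module.Finite R M]
    {n : ℕ} (hd : dlt R M (n+1)) : assh R M n = ash R M n := by
  ext p
  constructor
  · rintro ⟨h1, h2⟩
    refine ⟨h1.isPrime, ass_supp h1, ?_⟩
    unfold dlt
    rw [Module.supportDim_quotient_eq_ringKrullDim, h2]
    exact lt_irrefl _
  · intro hp
    refine ⟨ash_ass hd hp, ?_⟩
    obtain ⟨h1, h2, h3⟩ := hp
    have h4 : dlt R (R ⧸ p) (n+1) := dlt_iff.mp hd ⟨p, h1⟩ h2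
    unfold dlt at h3 h4
    rw [Module.supportDim_quotient_eq_ringKrullDim] at h3 h4
    refine le_antisymm ?_ (not_lt.mp h3)
    generalize ringKrullDim (R ⧸ p) = d at h4
    induction d using WithBot.recBotCoe with
    | bot => exact bot_le
    | coe d =>
      have h5 : d < ((n + 1 : ℕ) : ℕ∞) := by exact_mod_cast h4
      have h6 : d ≤ (n : ℕ∞) := by
        rw [Nat.cast_add, Nat.cast_one] at h5
        exact Order.le_of_lt_add_one h5
      exact WithBot.coe_le_coe.mpr h6

end LC
end

theorem stmt9 (R : Type u) [CommRing R] [IsNoetherianRing R] [IsLocalRing R]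
    [IsAdicComplete (IsLocalRing.maximalIdeal R) R]
    (M : Type u) [AddCommGroup M] [Module R M] [Module.Finite R M]
    (n : ℕ) (hn : 1 ≤ n)
    (hdim : ringKrullDim (R ⧸ Module.annihilator R M) = (n : WithBot (WithTop ℕ))) :
    Nat.card (Quotient (topLCIsoSetoid R M n)) = 2 ^ (assh R M n).ncard := by
  have hsd : Module.supportDim R M = (n : WithBot (WithTop ℕ)) :=
    (Module.supportDim_eq_ringKrullDim_quotient_annihilator R M).trans hdim
  have hd : LC.dlt R M (n+1) := by
    have h : (n : WithBot ℕ∞) < ((n + 1 : ℕ) : WithBot ℕ∞) := by exact_mod_cast Nat.lt_succ_self n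
    exact lt_of_eq_of_lt hsd h
  rw [LC.assh_eq hd]
  have key : ∀ a b : Ideal R, (topLCIsoSetoid R M n).r a b ↔ LC.TT M n a = LC.TT M n b := by
    intro a b
    constructor
    · rintro ⟨e⟩
      exact le_antisymm (LC.distinct hn hd e) (LC.distinct hn hd e.symm)
    · intro h
      obtain ⟨e1⟩ := LC.struct hn hd a
      obtain ⟨e2⟩ := LC.struct hn hd b
      rw [h] at e1
      exact ⟨e1.trans e2.symm⟩
  let F : Quotient (topLCIsoSetoid R M n) → (𝒫 (LC.ash R M n) : Set (Set (Ideal R))) :=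
    Quotient.lift (fun a => ⟨LC.TT M n a, fun p hp => hp.1⟩) (fun a b h => Subtype.ext ((key a b).mp h))
  have hF : Function.Bijective F := by
    constructor
    · intro x y
      induction x using Quotient.inductionOn with | _ a
      induction y using Quotient.inductionOn with | _ b
      intro h
      exact Quotient.sound ((key a b).mpr (congrArg Subtype.val h))
    · rintro ⟨T, hT⟩
      obtain ⟨a, ha⟩ := LC.realize hn hd T hT
      exact ⟨Quotient.mk _ a, Subtype.ext ha⟩
  rw [Nat.card_congr (Equiv.ofBijective F hF), Nat.card_coe_set_eq]
  exact Set.ncard_powerset _ (LC.ash_fin hd)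

end
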